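/- arXiv:1809.09158 — 2 statements merged into one kernel-verified Lean document; each statement's English description precedes it below -/
import Mathlib

section
/- For every word w, the number of words u with fast(u) = w equals the sum over all configurations H in H_R(w) of C_{q^H}, and the number of words u with slow(u) = w equals the sum over all configurations H in H_L(w) of C_{q^H}. -/
lemma foldr_max_mem {w : List ℕ} (h : w ≠ []) : w.foldr max 0 ∈ w := by
  induction w with
  | nil => exact absurd rfl h
  | cons a l ih =>
    rcases eq_or_ne l [] with rfl | hl
    · simp
    · have hm := ih hl
      simp only [List.foldr_cons]
      rcases max_choice a (l.foldr max 0) with h' | h' <;> rw [h']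
      · exact List.mem_cons_self
      · exact List.mem_cons_of_mem _ hm

lemma headI_mem {α : Type*} [Inhabited α] {l : List α} (h : l ≠ []) : l.headI ∈ l := by
  cases l with
  | nil => exact absurd rfl h
  | cons a t => simp

/-- `blocks n w` is the list of maximal (possibly empty) blocks of `w`
separated by occurrences of the letter `n`; that is, if `n` occurs `k` times
in `w`, then `blocks n w = [A₁, A₂, …, A_{k+1}]` where `w = A₁ n A₂ n ⋯ n A_{k+1}`
and no `Aᵢ` contains the letter `n`. -/
def blocks (n : ℕ) : List ℕ → List (List ℕ)
  | [] => [[]]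
  | a :: l =>
    if a = n then [] :: blocks n l
    else (a :: (blocks n l).headI) :: (blocks n l).tail

lemma blocks_ne_nil (n : ℕ) (w : List ℕ) : blocks n w ≠ [] := by
  cases w with
  | nil => simp [blocks]
  | cons a l =>
    simp only [blocks]
    split <;> simp

lemma blocks_length {n : ℕ} {w : List ℕ} : ∀ {A : List ℕ}, A ∈ blocks n w →
    A.length + w.count n ≤ w.length := by
  induction w with
  | nil =>
    intro A hA
    simp only [blocks, List.mem_singleton] at hA
    subst hA; simp
  | cons a l ih =>
    intro A hA
    by_cases h : a = n
    · subst h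
      simp only [blocks, if_pos rfl] at hA
      have hcc : (a :: l).count a = l.count a + 1 := by simp
      cases hA with
      | head =>
        have := List.count_le_length (a := a) (l := l)
        simp only [List.length_nil, List.length_cons, hcc]
        omega
      | tail _ h1 =>
        have := ih h1
        simp only [List.length_cons, hcc]
        omega
    · simp only [blocks, if_neg h] at hA
      have hcc : (a :: l).count n = l.count n := by
        simp [List.count_cons, h]
      cases hA with
      | head =>
        have := ih (headI_mem (blocks_ne_nil n l))
        simp only [List.length_cons, hcc]
        omega
      | tail _ h1 =>
        have := ih (List.mem_of_mem_tail h1)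
        simp only [List.length_cons, hcc]
        omega

/-- The generalized stack-sorting map `fast` (the convention in which a letter may
sit on top of a copy of itself in the stack): `fast ε = ε`, and if
`w = A₁ n A₂ n ⋯ n A_{k+1}` where `n` is the largest letter of `w` (occurring
`k` times) and the `Aᵢ` contain only letters smaller than `n`, then
`fast w = fast A₁ ++ fast A₂ ++ ⋯ ++ fast A_{k+1} ++ n ⋯ n` (with `k` copies of `n`). -/
def fast (w : List ℕ) : List ℕ :=
  if h : w = [] then []
  else
    ((blocks (w.foldr max 0) w).attach.map
      fun (A : {x // x ∈ blocks (w.foldr max 0) w}) =>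
      have : A.1.length < w.length := by
        have h1 := blocks_length A.2
        have h2 : 0 < w.count (w.foldr max 0) :=
          List.count_pos_iff.mpr (foldr_max_mem h)
        omega
      fast A.1).flatten ++ List.replicate (w.count (w.foldr max 0)) (w.foldr max 0)
termination_by w.length

/-- The generalized stack-sorting map `slow` (the convention in which a letter may
not sit on top of a copy of itself in the stack): `slow ε = ε`, and if
`w = A₁ n A₂ n ⋯ n A_{k+1}` where `n` is the largest letter of `w` (occurring
`k` times) and the `Aᵢ` contain only letters smaller than `n`, then
`slow w = slow A₁ ++ slow A₂ ++ [n] ++ slow A₃ ++ [n] ++ ⋯ ++ slow A_{k+1} ++ [n]`. -/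
def slow (w : List ℕ) : List ℕ :=
  if h : w = [] then []
  else
    (have : (blocks (w.foldr max 0) w).headI.length < w.length := by
      have h1 := blocks_length (headI_mem (blocks_ne_nil (w.foldr max 0) w))
      have h2 : 0 < w.count (w.foldr max 0) :=
        List.count_pos_iff.mpr (foldr_max_mem h)
      omega
     slow (blocks (w.foldr max 0) w).headI) ++
    ((blocks (w.foldr max 0) w).tail.attach.map
      fun (A : {x // x ∈ (blocks (w.foldr max 0) w).tail}) =>
      have : A.1.length < w.length := by
        have h1 := blocks_length (List.mem_of_mem_tail A.2)
        have h2 : 0 < w.count (w.foldr max 0) :=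
          List.count_pos_iff.mpr (foldr_max_mem h)
        omega
      slow A.1 ++ [w.foldr max 0]).flatten
termination_by w.length

/-- The `i`-th entry (1-indexed) of the word `w`, i.e. the height of the point
`(i, w_i)` of the plot of `w`. -/
def entry (w : List ℕ) (i : ℕ) : ℕ := w.getD (i - 1) 0

/-- A hook of `w`: a pair of points `(i, w_i)` (the southwest endpoint) and
`(j, w_j)` (the northeast endpoint) of the plot of `w` with `i < j` and `w_i ≤ w_j`.
We record a hook as the pair `(i, j)` of indices (1-indexed). -/
def IsHook (w : List ℕ) (h : ℕ × ℕ) : Prop :=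
  1 ≤ h.1 ∧ h.1 < h.2 ∧ h.2 ≤ w.length ∧ entry w h.1 ≤ entry w h.2

/-- `d` is a descent of `w`: `1 ≤ d ≤ m - 1` and `w_d ≥ w_{d+1}`. -/
def IsDescent (w : List ℕ) (d : ℕ) : Prop :=
  1 ≤ d ∧ d + 1 ≤ w.length ∧ entry w (d + 1) ≤ entry w d

/-- `H = (H₁, …, H_k)` is a valid hook configuration of `w`:
(1) the southwest endpoints have strictly increasing indices `i₁ < ⋯ < i_k`;
(2) each descent top of `w` is the southwest endpoint of a hook;
(3) each point that is the northeast endpoint of a hook is the northeast endpoint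
of a descent hook and also of a small hook;
(4) the open intervals `(i_u, j_u)` are pairwise disjoint or nested. -/
def IsVHC (w : List ℕ) (H : List (ℕ × ℕ)) : Prop :=
  (∀ h ∈ H, IsHook w h) ∧
  (H.map Prod.fst).Pairwise (· < ·) ∧
  (∀ d : ℕ, IsDescent w d → ∃ h ∈ H, h.1 = d) ∧
  (∀ j : ℕ, (∃ h ∈ H, h.2 = j) →
      (∃ h ∈ H, h.2 = j ∧ IsDescent w h.1) ∧ (∃ h ∈ H, h.2 = j ∧ h.2 = h.1 + 1)) ∧
  (∀ h ∈ H, ∀ h' ∈ H,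
      (Set.Ioo h.1 h.2 : Set ℕ) ∩ Set.Ioo h'.1 h'.2 = ∅ ∨
      (Set.Ioo h.1 h.2 : Set ℕ) ⊆ Set.Ioo h'.1 h'.2 ∨
      (Set.Ioo h'.1 h'.2 : Set ℕ) ⊆ Set.Ioo h.1 h.2)

/-- The point `(a, w_a)` "sees" the hook `h` when it looks up: either `(a, w_a)`
lies strictly below `h`, or `(a, w_a)` is the northeast endpoint of `h`. -/
def seesHook (w : List ℕ) (h : ℕ × ℕ) (a : ℕ) : Prop :=
  (h.1 < a ∧ a < h.2 ∧ entry w a ≤ entry w h.2) ∨ a = h.2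

instance (w : List ℕ) (h : ℕ × ℕ) (a : ℕ) : Decidable (seesHook w h a) := by
  unfold seesHook; infer_instance

/-- The color that the point `(a, w_a)` receives in the coloring induced by the
configuration `H = (H₁, …, H_k)` (indices of hooks are 1-based): among all hooks
that the point sees, it receives the color of the one whose southwest endpoint is
rightmost (for a valid hook configuration, this is the hook with the largest index,
since `i₁ < ⋯ < i_k`); if it sees no hook, it receives the color `0` (blue). -/
def colorOf (w : List ℕ) (H : List (ℕ × ℕ)) (a : ℕ) : ℕ :=
  ((Finset.range H.length).filter fun u => seesHook w (H.getD u (0, 0)) a).sup (· + 1)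

/-- `C_{q^H} = C_{q₀} C_{q₁} ⋯ C_{q_k}`, where `q^H = (q₀, …, q_k)` is the
composition induced by the configuration `H = (H₁, …, H_k)` of `w`: `q_t` is the
number of points of the plot of `w` colored `t` in the induced coloring, and
`C_n` is the `n`-th Catalan number. -/
def CatComp (w : List ℕ) (H : List (ℕ × ℕ)) : ℕ :=
  ∏ t ∈ Finset.range (H.length + 1),
    catalan (((Finset.Icc 1 w.length).filter fun a => colorOf w H a = t).card)

/-- `H` is a binary valid hook configuration: each point is the northeast endpoint
of at most two hooks. -/
def IsBinaryVHC (w : List ℕ) (H : List (ℕ × ℕ)) : Prop :=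
  IsVHC w H ∧ ∀ j : ℕ, (H.countP fun h => h.2 == j) ≤ 2

/-- `H_R(w)`: the set of binary valid hook configurations of `w` in which every
horizontal hook is small. -/
def HR (w : List ℕ) : Set (List (ℕ × ℕ)) :=
  {H | IsBinaryVHC w H ∧ ∀ h ∈ H, entry w h.1 = entry w h.2 → h.2 = h.1 + 1}

/-- `H_L(w)`: the set of binary valid hook configurations of `w` in which no small
horizontal hook has the same northeast endpoint as another hook. -/
def HL (w : List ℕ) : Set (List (ℕ × ℕ)) :=
  {H | IsBinaryVHC w H ∧ ∀ h ∈ H, h.2 = h.1 + 1 → entry w h.1 = entry w h.2 →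
      ∀ h' ∈ H, h' ≠ h → h'.2 ≠ h.2}

/-- The relation required between a left child and its parent: strict for `fast`
(`b = true`), weak for `slow` (`b = false`). -/
def LeftRel (b : Bool) (x y : ℕ) : Prop := if b then x < y else x ≤ y

/-- The relation required between a right child and its parent: weak for `fast`
(`b = true`), strict for `slow` (`b = false`). -/
def RightRel (b : Bool) (x y : ℕ) : Prop := if b then x ≤ y else x < y

/-- Valid hook configurations of the word `e (A+1), …, e B`, as sets of hooks. -/
structure SegVHC (e : ℕ → ℕ) (b : Bool) (A B : ℕ) (S : Finset (ℕ × ℕ)) : Prop where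
  lower : ∀ i j, (i, j) ∈ S → A < i
  lt : ∀ i j, (i, j) ∈ S → i < j
  upper : ∀ i j, (i, j) ∈ S → j ≤ B
  le : ∀ i j, (i, j) ∈ S → e i ≤ e j
  inj : ∀ i j j', (i, j) ∈ S → (i, j') ∈ S → j = j'
  desc : ∀ d, A < d → d < B → e (d + 1) ≤ e d → ∃ j, (d, j) ∈ S
  small : ∀ i j, (i, j + 1) ∈ S → (j, j + 1) ∈ S
  descHook : ∀ i j, (i, j) ∈ S → ∃ d, (d, j) ∈ S ∧ e (d + 1) ≤ e d
  noncrossing : ∀ i j i' j', (i, j) ∈ S → (i', j') ∈ S → i < i' → i' < j → j' ≤ j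
  binary : ∀ i i' j, (i, j) ∈ S → (i', j) ∈ S → i + 1 < j → i' + 1 < j → i = i'
  rel : ∀ i j, (i, j + 1) ∈ S → i < j →
    LeftRel b (e i) (e (j + 1)) ∧ RightRel b (e j) (e (j + 1))

section SegVHC

variable {e : ℕ → ℕ} {b : Bool} {A B l : ℕ} {S S₁ S₂ : Finset (ℕ × ℕ)}

lemma SegVHC.le_of_below (h : SegVHC e b A B S) {i j : ℕ} (hij : (i, j) ∈ S) {a : ℕ}
    (ha : i < a) (haj : a ≤ j) : e a ≤ e j := by
  obtain ⟨k, rfl⟩ : ∃ k, j = a + k := ⟨j - a, by omega⟩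
  induction k using Nat.strong_induction_on generalizing a with
  | _ k ih =>
    rcases Nat.eq_zero_or_pos k with rfl | hk
    · rfl
    by_cases hd : e (a + 1) ≤ e a
    · obtain ⟨j', hj'⟩ := h.desc a (by have := h.lower _ _ hij; omega)
        (by have := h.upper _ _ hij; omega) hd
      have h1 := h.noncrossing _ _ _ _ hij hj' ha (by omega)
      have h2 := h.lt _ _ hj'
      have h3 := h.le _ _ hj'
      have := ih (a + k - j') (by omega) (a := j')
      rw [show j' + (a + k - j') = a + k by omega] at this
      exact h3.trans (this (by omega) hij (by omega))
    · have := ih (k - 1) (by omega) (a := a + 1)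
      rw [show a + 1 + (k - 1) = a + k by omega] at this
      have := this (by omega) hij (by omega)
      omega

lemma SegVHC.le_last (h : SegVHC e b A B S) {a : ℕ} (ha : A < a) (haB : a ≤ B) :
    e a ≤ e B := by
  obtain ⟨k, rfl⟩ : ∃ k, B = a + k := ⟨B - a, by omega⟩
  induction k using Nat.strong_induction_on generalizing a with
  | _ k ih =>
    rcases Nat.eq_zero_or_pos k with rfl | hk
    · rfl
    by_cases hd : e (a + 1) ≤ e a
    · obtain ⟨j', hj'⟩ := h.desc a ha (by omega) hd
      have h1 := h.upper _ _ hj'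
      have h2 := h.lt _ _ hj'
      have h3 := h.le _ _ hj'
      have := ih (a + k - j') (by omega) (a := j')
      rw [show j' + (a + k - j') = a + k by omega] at this
      exact h3.trans (this (by omega) h (by omega))
    · have := ih (k - 1) (by omega) (a := a + 1)
      rw [show a + 1 + (k - 1) = a + k by omega] at this
      have := this (by omega) h (by omega)
      omega

/-- The split of `(A, B]` into `(A, l]` and `(l, B]` is compatible with the letter `e (B + 1)`
being the parent of the last letters of both parts. -/
def SplitRel (e : ℕ → ℕ) (b : Bool) (A B l : ℕ) : Prop :=
  (∀ a, A < a → a ≤ l → LeftRel b (e a) (e (B + 1))) ∧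
    (∀ a, l < a → a ≤ B → RightRel b (e a) (e (B + 1)))

/-- One of the children of `B + 1` is a descent top. -/
def SplitDesc (e : ℕ → ℕ) (A B l : ℕ) : Prop :=
  (A < l ∧ e (l + 1) ≤ e l) ∨ (A < B ∧ e (B + 1) ≤ e B)

open Classical in
/-- The hooks with northeast endpoint `B + 1` created by a split at `l`. -/
noncomputable def newHooks (e : ℕ → ℕ) (A B l : ℕ) : Finset (ℕ × ℕ) :=
  ({(l, B + 1), (B, B + 1)} : Finset (ℕ × ℕ)).filter fun h => A < h.1 ∧ SplitDesc e A B l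

lemma mem_newHooks {h : ℕ × ℕ} : h ∈ newHooks e A B l ↔
    (h = (l, B + 1) ∨ h = (B, B + 1)) ∧ A < h.1 ∧ SplitDesc e A B l := by
  simp [newHooks]

/-- The hooks lying over the segment `(A, B]`. -/
def restrictHooks (A B : ℕ) (S : Finset (ℕ × ℕ)) : Finset (ℕ × ℕ) :=
  S.filter fun h => A < h.1 ∧ h.2 ≤ B

lemma mem_restrictHooks {h : ℕ × ℕ} : h ∈ restrictHooks A B S ↔ h ∈ S ∧ A < h.1 ∧ h.2 ≤ B := by
  simp [restrictHooks]

lemma mem_joinHooks (i j : ℕ) : (i, j) ∈ S₁ ∪ S₂ ∪ newHooks e A B l ↔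
    (i, j) ∈ S₁ ∨ (i, j) ∈ S₂ ∨ ((i = l ∨ i = B) ∧ j = B + 1 ∧ A < i ∧ SplitDesc e A B l) := by
  simp only [Finset.mem_union, mem_newHooks, Prod.mk.injEq]
  tauto

lemma SegVHC.join (hl : A ≤ l) (hlB : l ≤ B) (hs : SplitRel e b A B l)
    (h₁ : SegVHC e b A l S₁) (h₂ : SegVHC e b l B S₂) :
    SegVHC e b A (B + 1) (S₁ ∪ S₂ ∪ newHooks e A B l) := by
  have hl1 : ∀ a, A < a → a ≤ l → e a ≤ e (B + 1) := fun a h h' => by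
    have := hs.1 a h h'; unfold LeftRel at this; split at this <;> omega
  have hl2 : ∀ a, l < a → a ≤ B → e a ≤ e (B + 1) := fun a h h' => by
    have := hs.2 a h h'; unfold RightRel at this; split at this <;> omega
  have hb1 : ∀ i j, (i, j) ∈ S₁ → A < i ∧ i < j ∧ j ≤ l := fun i j h =>
    ⟨h₁.lower _ _ h, h₁.lt _ _ h, h₁.upper _ _ h⟩
  have hb2 : ∀ i j, (i, j) ∈ S₂ → l < i ∧ i < j ∧ j ≤ B := fun i j h =>
    ⟨h₂.lower _ _ h, h₂.lt _ _ h, h₂.upper _ _ h⟩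
  constructor <;> simp only [mem_joinHooks]
  · grind
  · grind
  · grind
  · intro i j h
    rcases h with h | h | ⟨h | h, rfl, h', -⟩
    · exact h₁.le _ _ h
    · exact h₂.le _ _ h
    · grind
    · grind
  · intro i j j' h h'
    rcases h with h | h | h <;> rcases h' with h' | h' | h'
    · exact h₁.inj _ _ _ h h'
    · grind
    · grind
    · grind
    · exact h₂.inj _ _ _ h h'
    · grind
    · grind
    · grind
    · grind
  · intro d hA hB hd
    rcases lt_trichotomy d l with hdl | rfl | hdl
    · obtain ⟨j, hj⟩ := h₁.desc d hA hdl hd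
      exact ⟨j, .inl hj⟩
    · exact ⟨B + 1, .inr (.inr ⟨.inl rfl, rfl, hA, .inl ⟨hA, hd⟩⟩)⟩
    · rcases Nat.lt_or_ge d B with hdB | hdB
      · obtain ⟨j, hj⟩ := h₂.desc d hdl hdB hd
        exact ⟨j, .inr (.inl hj)⟩
      · obtain rfl : d = B := by omega
        exact ⟨d + 1, .inr (.inr ⟨.inr rfl, rfl, hA, .inr ⟨hA, hd⟩⟩)⟩
  · intro i j h
    rcases h with h | h | h
    · exact .inl (h₁.small _ _ h)
    · exact .inr (.inl (h₂.small _ _ h))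
    · grind
  · intro i j h
    rcases h with h | h | ⟨-, rfl, -, h⟩
    · obtain ⟨d, hd, hd'⟩ := h₁.descHook _ _ h
      exact ⟨d, .inl hd, hd'⟩
    · obtain ⟨d, hd, hd'⟩ := h₂.descHook _ _ h
      exact ⟨d, .inr (.inl hd), hd'⟩
    · have h' := h
      rcases h' with ⟨h1, h2⟩ | ⟨h1, h2⟩
      · exact ⟨l, .inr (.inr ⟨.inl rfl, rfl, h1, h⟩), h2⟩
      · exact ⟨B, .inr (.inr ⟨.inr rfl, rfl, h1, h⟩), h2⟩
  · intro i j i' j' h h'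
    rcases h with h | h | h <;> rcases h' with h' | h' | h'
    · exact h₁.noncrossing _ _ _ _ h h'
    · grind
    · grind
    · grind
    · exact h₂.noncrossing _ _ _ _ h h'
    · grind
    · grind
    · grind
    · grind
  · intro i i' j h h'
    rcases h with h | h | h <;> rcases h' with h' | h' | h'
    · exact h₁.binary _ _ _ h h'
    · grind
    · grind
    · grind
    · exact h₂.binary _ _ _ h h'
    · grind
    · grind
    · grind
    · grind
  · intro i j h hij
    rcases h with h | h | ⟨h | h, h', h3, h4⟩
    · exact h₁.rel _ _ h hij
    · exact h₂.rel _ _ h hij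
    · obtain rfl : j = B := by omega
      subst h
      exact ⟨hs.1 _ h3 le_rfl, hs.2 _ hij le_rfl⟩
    · omega

lemma SegVHC.restrict (hl : A ≤ l) (hlB : l ≤ B) (h : SegVHC e b A (B + 1) S)
    (hS : S = restrictHooks A l S ∪ restrictHooks l B S ∪ newHooks e A B l) :
    SegVHC e b A l (restrictHooks A l S) ∧ SegVHC e b l B (restrictHooks l B S) := by
  have key : ∀ i j, (i, j) ∈ S →
      (A < i ∧ j ≤ l) ∨ (l < i ∧ j ≤ B) ∨ ((i = l ∨ i = B) ∧ j = B + 1) := by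
    intro i j hij
    rw [hS, mem_joinHooks, mem_restrictHooks, mem_restrictHooks] at hij
    tauto
  have hlow := h.lower
  have hlt := h.lt
  constructor
  · constructor <;> simp only [mem_restrictHooks]
    · grind
    · grind
    · grind
    · exact fun i j hij => h.le _ _ hij.1
    · exact fun i j j' hij hij' => h.inj _ _ _ hij.1 hij'.1
    · intro d h1 h2 h3
      obtain ⟨j, hj⟩ := h.desc d h1 (by omega) h3
      exact ⟨j, hj, by grind⟩
    · intro i j hij
      have := h.small _ _ hij.1
      grind
    · intro i j hij
      obtain ⟨d, hd, hd'⟩ := h.descHook _ _ hij.1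
      exact ⟨d, by grind⟩
    · exact fun i j i' j' hij hij' => h.noncrossing _ _ _ _ hij.1 hij'.1
    · exact fun i i' j hij hij' => h.binary _ _ _ hij.1 hij'.1
    · exact fun i j hij => h.rel _ _ hij.1
  · constructor <;> simp only [mem_restrictHooks]
    · grind
    · grind
    · grind
    · exact fun i j hij => h.le _ _ hij.1
    · exact fun i j j' hij hij' => h.inj _ _ _ hij.1 hij'.1
    · intro d h1 h2 h3
      obtain ⟨j, hj⟩ := h.desc d (by omega) (by omega) h3
      exact ⟨j, hj, by grind⟩
    · intro i j hij
      have := h.small _ _ hij.1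
      grind
    · intro i j hij
      obtain ⟨d, hd, hd'⟩ := h.descHook _ _ hij.1
      exact ⟨d, by grind⟩
    · exact fun i j i' j' hij hij' => h.noncrossing _ _ _ _ hij.1 hij'.1
    · exact fun i i' j hij hij' => h.binary _ _ _ hij.1 hij'.1
    · exact fun i j hij => h.rel _ _ hij.1

/-- The restrictions of `S` to `(A, l]` and `(l, B]`, and the new hooks of a split at `l`,
together make up `S`. -/
def SplitsAt (e : ℕ → ℕ) (A B l : ℕ) (S : Finset (ℕ × ℕ)) : Prop :=
  S = restrictHooks A l S ∪ restrictHooks l B S ∪ newHooks e A B l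

lemma splitsAt_iff : SplitsAt e A B l S ↔ ∀ i j, (i, j) ∈ S ↔
    ((i, j) ∈ S ∧ A < i ∧ j ≤ l) ∨ ((i, j) ∈ S ∧ l < i ∧ j ≤ B) ∨
      ((i = l ∨ i = B) ∧ j = B + 1 ∧ A < i ∧ SplitDesc e A B l) := by
  unfold SplitsAt
  constructor
  · intro h i j
    conv_lhs => rw [h, mem_joinHooks, mem_restrictHooks, mem_restrictHooks]
  · intro h
    ext ⟨i, j⟩
    rw [mem_joinHooks, mem_restrictHooks, mem_restrictHooks]
    exact h i j

lemma leftRel_of_le {x y z : ℕ} (h : x ≤ y) (h' : LeftRel b y z) : LeftRel b x z := by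
  cases b <;> simp only [LeftRel] at * <;> grind

lemma rightRel_of_le {x y z : ℕ} (h : x ≤ y) (h' : RightRel b y z) : RightRel b x z := by
  cases b <;> simp only [RightRel] at * <;> grind

lemma SegVHC.splitRel (hl : A ≤ l) (hlB : l ≤ B) (h : SegVHC e b A (B + 1) S)
    (hS : SplitsAt e A B l S) (h₁ : A < l → LeftRel b (e l) (e (B + 1)))
    (h₂ : l < B → RightRel b (e B) (e (B + 1))) : SplitRel e b A B l := by
  obtain ⟨h1, h2⟩ := h.restrict hl hlB hS
  exact ⟨fun a ha hal => leftRel_of_le (h1.le_last ha hal) (h₁ (by omega)),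
    fun a ha hal => rightRel_of_le (h2.le_last ha hal) (h₂ (by omega))⟩

lemma SegVHC.exists_split (h : SegVHC e b A (B + 1) S) (hAB : A ≤ B) {i₀ : ℕ}
    (hS : (i₀, B + 1) ∈ S) :
    ∃ l, A ≤ l ∧ l ≤ B ∧ SplitDesc e A B l ∧ SplitRel e b A B l ∧ SplitsAt e A B l S ∧
      ∀ l', A ≤ l' → l' ≤ B → SplitRel e b A B l' → SplitsAt e A B l' S → l' = l := by
  have hB := h.small _ _ hS
  have hAB' := h.lower _ _ hB
  have hlow := h.lower
  have hlt := h.lt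
  have hup := h.upper
  by_cases hex : ∃ l, l < B ∧ (l, B + 1) ∈ S
  · obtain ⟨l, hl, hlS⟩ := hex
    have hAl := h.lower _ _ hlS
    have hend : ∀ i, (i, B + 1) ∈ S → i = l ∨ i = B := by
      intro i hi
      have := h.binary i l _ hi hlS
      have := h.lt _ _ hi
      omega
    have hsd : SplitDesc e A B l := by
      obtain ⟨d, hd, hd'⟩ := h.descHook _ _ hlS
      rcases hend _ hd with rfl | rfl
      · exact .inl ⟨hAl, hd'⟩
      · exact .inr ⟨hAB', hd'⟩
    have hsp : SplitsAt e A B l S := by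
      rw [splitsAt_iff]
      intro i j
      constructor
      · intro hij
        have h1 := hlow _ _ hij
        have h2 := hup _ _ hij
        have h3 := hlt _ _ hij
        by_cases hj : j = B + 1
        · subst hj
          exact .inr (.inr ⟨hend _ hij, rfl, h1, hsd⟩)
        · have h4 := h.noncrossing _ _ _ _ hij hlS
          have h5 : i = l → j = B + 1 := by
            rintro rfl
            exact h.inj _ _ _ hij hlS
          rcases Nat.lt_or_ge l i with hli | hli
          · exact .inr (.inl ⟨hij, hli, by omega⟩)
          · exact .inl ⟨hij, h1, by omega⟩
      · rintro (h' | h' | ⟨rfl | rfl, rfl, -⟩)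
        · exact h'.1
        · exact h'.1
        · exact hlS
        · exact hB
    have hrel := h.rel _ _ hlS hl
    refine ⟨l, hAl.le, hl.le, hsd, h.splitRel hAl.le hl.le hsp (fun _ => hrel.1)
      (fun _ => hrel.2), hsp, ?_⟩
    intro l' hA' hl' hr hs
    have h1 := (splitsAt_iff.1 hs l (B + 1)).1 hlS
    omega
  · push Not at hex
    have hend : ∀ i, (i, B + 1) ∈ S → i = B := by
      intro i hi
      have := hlt _ _ hi
      by_contra
      exact hex i (by omega) hi
    have heq : e (B + 1) = e B := by
      obtain ⟨d, hd, hd'⟩ := h.descHook _ _ hS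
      obtain rfl := hend _ hd
      exact le_antisymm hd' (h.le _ _ hB)
    have hsd : ∀ l, SplitDesc e A B l := fun l => .inr ⟨hAB', heq.le⟩
    have hsp : ∀ l, (l = A ∨ l = B) → SplitsAt e A B l S := by
      intro l hl
      rw [splitsAt_iff]
      intro i j
      have h1 := hlow i j
      have h2 := hup i j
      constructor
      · intro hij
        by_cases hj : j = B + 1
        · subst hj
          exact .inr (.inr ⟨.inr (hend _ hij), rfl, h1 hij, hsd l⟩)
        · have := h1 hij
          have := h2 hij
          rcases hl with rfl | rfl
          · exact .inr (.inl ⟨hij, h1 hij, by omega⟩)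
          · exact .inl ⟨hij, h1 hij, by omega⟩
      · rintro (h' | h' | ⟨hi, rfl, h', -⟩)
        · exact h'.1
        · exact h'.1
        · obtain rfl : i = B := by omega
          exact hB
    cases b
    · refine ⟨B, hAB, le_rfl, hsd _, h.splitRel hAB le_rfl (hsp _ (.inr rfl)) ?_ ?_,
        hsp _ (.inr rfl), ?_⟩
      · simp [LeftRel, heq]
      · omega
      · intro l' hA' hl' hr hs
        by_contra hne
        have := hr.2 B (by omega) le_rfl
        simp [RightRel, heq] at this
    · refine ⟨A, le_rfl, hAB, hsd _, h.splitRel le_rfl hAB (hsp _ (.inl rfl)) ?_ ?_,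
        hsp _ (.inl rfl), ?_⟩
      · omega
      · simp [RightRel, heq]
      · intro l' hA' hl' hr hs
        by_contra hne
        have h1 := (splitsAt_iff.1 hs l' (B + 1)).2
          (.inr (.inr ⟨.inl rfl, rfl, by omega, hsd _⟩))
        obtain rfl := hend _ h1
        have := hr.1 l' (by omega) le_rfl
        simp [LeftRel, heq] at this

/-- The position `a` lies below no hook of `S`. -/
def IsBlue (S : Finset (ℕ × ℕ)) (a : ℕ) : Prop := ∀ i j, (i, j) ∈ S → ¬ (i < a ∧ a ≤ j)

/-- The hook of `S` starting at `c` is the innermost hook of `S` over the position `a`. -/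
def OwnedBy (S : Finset (ℕ × ℕ)) (c a : ℕ) : Prop :=
  (∃ j, (c, j) ∈ S ∧ c < a ∧ a ≤ j) ∧ ∀ i j, (i, j) ∈ S → i < a → a ≤ j → i ≤ c

lemma SegVHC.split_iff_isBlue (h : SegVHC e b A (B + 1) S) (hl : A ≤ l) (hlB : l ≤ B)
    (hS : ∀ i, (i, B + 1) ∉ S) :
    (SplitRel e b A B l ∧ SplitsAt e A B l S) ↔ IsBlue S (l + 1) := by
  constructor
  · rintro ⟨-, hs⟩ i j hij ⟨h1, h2⟩
    rcases (splitsAt_iff.1 hs i j).1 hij with h' | h' | ⟨-, rfl, -⟩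
    · omega
    · omega
    · exact hS _ hij
  · intro hb
    have hB : A < B → e B < e (B + 1) := by
      intro hAB
      by_contra hd
      obtain ⟨j, hj⟩ := h.desc B hAB (by omega) (by omega)
      have := h.lt _ _ hj
      have := h.upper _ _ hj
      obtain rfl : j = B + 1 := by omega
      exact hS _ hj
    have hl' : A < l → e l < e (l + 1) := by
      intro hAl
      by_contra hd
      obtain ⟨j, hj⟩ := h.desc l hAl (by omega) (by omega)
      have := h.lt _ _ hj
      exact hb _ _ hj ⟨by omega, by omega⟩
    have hnsd : ¬ SplitDesc e A B l := by
      rintro (⟨h1, h2⟩ | ⟨h1, h2⟩)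
      · have := hl' h1; omega
      · have := hB h1; omega
    have hsp : SplitsAt e A B l S := by
      rw [splitsAt_iff]
      intro i j
      constructor
      · intro hij
        have := h.lower _ _ hij
        have := h.upper _ _ hij
        have h1 := hb _ _ hij
        have : j ≠ B + 1 := by
          rintro rfl
          exact hS _ hij
        have : (A < i ∧ j ≤ l) ∨ (l < i ∧ j ≤ B) := by omega
        tauto
      · tauto
    refine ⟨h.splitRel hl hlB hsp (fun hAl => ?_) (fun hAl => ?_), hsp⟩
    · have := hl' hAl
      have := h.le_last (a := l + 1) (by omega) (by omega)
      unfold LeftRel; split <;> omega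
    · have := hB (by omega)
      unfold RightRel; split <;> omega

open Classical in
/-- The number of positions in `(A, B]` satisfying `p`. -/
noncomputable def countIoc (A B : ℕ) (p : ℕ → Prop) : ℕ := ((Finset.Ioc A B).filter p).card

lemma countIoc_congr {p q : ℕ → Prop} (h : ∀ a, A < a → a ≤ B → (p a ↔ q a)) :
    countIoc A B p = countIoc A B q := by
  classical
  unfold countIoc
  congr 1
  ext a
  simp only [Finset.mem_filter, Finset.mem_Ioc]
  grind

lemma countIoc_eq_zero {p : ℕ → Prop} (h : ∀ a, A < a → a ≤ B → ¬ p a) :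
    countIoc A B p = 0 := by
  classical
  unfold countIoc
  rw [Finset.card_eq_zero, Finset.filter_eq_empty_iff]
  grind

lemma countIoc_add (hl : A ≤ l) (hlB : l ≤ B) (p : ℕ → Prop) :
    countIoc A B p = countIoc A l p + countIoc l B p := by
  classical
  unfold countIoc
  rw [← Finset.Ioc_union_Ioc_eq_Ioc hl hlB, Finset.filter_union, Finset.card_union_of_disjoint]
  rw [Finset.disjoint_left]
  grind

open Classical in
lemma countIoc_succ (p : ℕ → Prop) : countIoc B (B + 1) p = if p (B + 1) then 1 else 0 := by
  unfold countIoc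
  rw [show Finset.Ioc B (B + 1) = {B + 1} by ext; simp, Finset.filter_singleton]
  split <;> rfl

lemma countIoc_split (hl : A ≤ l) (hlB : l ≤ B) (p : ℕ → Prop) :
    countIoc A (B + 1) p = countIoc A l p + countIoc l B p + countIoc B (B + 1) p := by
  rw [countIoc_add hl (hlB.trans B.le_succ), countIoc_add hlB B.le_succ, add_assoc]

/-- The Catalan weight of a hook configuration of the word `e (A+1), …, e B`; all hooks are
assumed to start before `N`. -/
noncomputable def hookWeight (N A B : ℕ) (S : Finset (ℕ × ℕ)) : ℕ :=
  catalan (countIoc A B (IsBlue S)) * ∏ c ∈ Finset.range N, catalan (countIoc A B (OwnedBy S c))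

lemma SplitsAt.left_congr (hs : SplitsAt e A B l S) (hlB : l ≤ B) {a : ℕ} (ha : a ≤ l) :
    (IsBlue S a ↔ IsBlue (restrictHooks A l S) a) ∧
      ∀ c, OwnedBy S c a ↔ OwnedBy (restrictHooks A l S) c a := by
  have key : ∀ i j, i < a → ((i, j) ∈ S ↔ (i, j) ∈ restrictHooks A l S) := by
    intro i j hi
    rw [mem_restrictHooks, splitsAt_iff.1 hs i j]
    constructor
    · rintro (h | h | h)
      · exact ⟨.inl h, h.2⟩
      · omega
      · omega
    · exact fun h => h.1
  unfold IsBlue OwnedBy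
  grind

lemma SplitsAt.right_congr (hs : SplitsAt e A B l S)
    (hl : A = l ∨ ¬ SplitDesc e A B l) {a : ℕ} (ha : l < a) (haB : a ≤ B) :
    (IsBlue S a ↔ IsBlue (restrictHooks l B S) a) ∧
      ∀ c, OwnedBy S c a ↔ OwnedBy (restrictHooks l B S) c a := by
  have key : ∀ i j, i < a → a ≤ j → ((i, j) ∈ S ↔ (i, j) ∈ restrictHooks l B S) := by
    intro i j hi haj
    rw [mem_restrictHooks, splitsAt_iff.1 hs i j]
    constructor
    · rintro (h | h | ⟨h1, h2, h3, h4⟩)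
      · omega
      · exact ⟨.inr (.inl h), h.2⟩
      · rcases hl with hl | hl
        · omega
        · exact absurd h4 hl
    · exact fun h => h.1
  unfold IsBlue OwnedBy
  grind

lemma SplitsAt.right_special (hs : SplitsAt e A B l S) (hl : A < l) (hd : SplitDesc e A B l)
    {a : ℕ} (ha : l < a) (haB : a ≤ B) :
    ¬ IsBlue S a ∧
      ∀ c, OwnedBy S c a ↔ OwnedBy (restrictHooks l B S) c a ∨
        (c = l ∧ IsBlue (restrictHooks l B S) a) := by
  have hlS : (l, B + 1) ∈ S := (splitsAt_iff.1 hs _ _).2 (.inr (.inr ⟨.inl rfl, rfl, hl, hd⟩))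
  have key : ∀ i j, i < a → a ≤ j → ((i, j) ∈ S ↔ (i, j) ∈ restrictHooks l B S ∨
      (i = l ∧ j = B + 1)) := by
    intro i j hi haj
    constructor
    · intro h
      have h' := (splitsAt_iff.1 hs i j).1 h
      rw [mem_restrictHooks]
      rcases h' with h' | h' | h'
      · omega
      · exact .inl h'
      · exact .inr (by omega)
    · rintro (h | ⟨rfl, rfl⟩)
      · exact (mem_restrictHooks.1 h).1
      · exact hlS
  have hlt : ∀ i j, (i, j) ∈ restrictHooks l B S → l < i := fun i j h =>
    (mem_restrictHooks.1 h).2.1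
  refine ⟨fun h => h _ _ hlS ⟨ha, by omega⟩, fun c => ?_⟩
  unfold IsBlue OwnedBy
  constructor
  · rintro ⟨⟨j, hj, h1, h2⟩, h3⟩
    rcases (key _ _ h1 h2).1 hj with h | ⟨rfl, rfl⟩
    · exact .inl ⟨⟨j, h, h1, h2⟩, fun i j hij hi haj => h3 i j ((key _ _ hi haj).2 (.inl hij)) hi haj⟩
    · refine .inr ⟨rfl, fun i j hij ⟨hi, haj⟩ => ?_⟩
      have := h3 i j ((key _ _ hi haj).2 (.inl hij)) hi haj
      have := hlt _ _ hij
      omega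
  · rintro (⟨⟨j, hj, h1, h2⟩, h3⟩ | ⟨rfl, h⟩)
    · refine ⟨⟨j, (key _ _ h1 h2).2 (.inl hj), h1, h2⟩, fun i j' hij hi haj => ?_⟩
      rcases (key _ _ hi haj).1 hij with h | ⟨rfl, rfl⟩
      · exact h3 _ _ h hi haj
      · exact (hlt _ _ hj).le
    · refine ⟨⟨B + 1, hlS, ha, by omega⟩, fun i j' hij hi haj => ?_⟩
      rcases (key _ _ hi haj).1 hij with h' | ⟨rfl, rfl⟩
      · exact absurd ⟨hi, haj⟩ (h _ _ h')
      · exact le_rfl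

lemma ownedBy_restrictHooks {c a : ℕ} (hc : OwnedBy (restrictHooks A B S) c a) : A < c ∧ c < B := by
  obtain ⟨⟨j, hj, h1, h2⟩, -⟩ := hc
  have := (mem_restrictHooks.1 hj).2
  omega

lemma catalan_add_of_eq_zero {m n : ℕ} (h : m = 0 ∨ n = 0) :
    catalan (m + n) = catalan m * catalan n := by
  rcases h with rfl | rfl <;> simp

lemma countIoc_ownedBy_eq_zero (c : ℕ) (S : Finset (ℕ × ℕ)) :
    countIoc A l (OwnedBy (restrictHooks A l S) c) = 0 ∨
      countIoc l B (OwnedBy (restrictHooks l B S) c) = 0 := by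
  rcases Nat.lt_or_ge l c with h | h
  · exact .inl (countIoc_eq_zero fun a _ _ hc => by have := ownedBy_restrictHooks hc; omega)
  · exact .inr (countIoc_eq_zero fun a _ _ hc => by have := ownedBy_restrictHooks hc; omega)

lemma SegVHC.hookWeight_special (h : SegVHC e b A (B + 1) S) (hs : SplitsAt e A B l S)
    (hl : A ≤ l) (hlB : l ≤ B) (hd : SplitDesc e A B l) {N : ℕ} (hN : B < N) :
    hookWeight N A (B + 1) S =
      hookWeight N A l (restrictHooks A l S) * hookWeight N l B (restrictHooks l B S) := by
  have hAB : A < B := by rcases hd with h | h <;> omega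
  have hBS : (B, B + 1) ∈ S := (splitsAt_iff.1 hs _ _).2 (.inr (.inr ⟨.inr rfl, rfl, hAB, hd⟩))
  have hlast : ¬ IsBlue S (B + 1) := fun h => h _ _ hBS ⟨by omega, by omega⟩
  have hlast' : ∀ c, OwnedBy S c (B + 1) ↔ c = B := by
    intro c
    constructor
    · rintro ⟨⟨j, hj, h1, h2⟩, h3⟩
      have := h3 _ _ hBS (by omega) le_rfl
      omega
    · rintro rfl
      exact ⟨⟨_, hBS, by omega, le_rfl⟩, fun i j _ hi _ => by omega⟩
  have hL1 : countIoc A l (IsBlue S) = countIoc A l (IsBlue (restrictHooks A l S)) :=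
    countIoc_congr fun a _ ha => (hs.left_congr hlB ha).1
  have hL2 : ∀ c, countIoc A l (OwnedBy S c) = countIoc A l (OwnedBy (restrictHooks A l S) c) :=
    fun c => countIoc_congr fun a _ ha => (hs.left_congr hlB ha).2 c
  have hC : ∀ c, catalan (countIoc A l (OwnedBy S c) + countIoc l B (OwnedBy S c) +
      countIoc B (B + 1) (OwnedBy S c)) =
      catalan (countIoc A l (OwnedBy S c)) * catalan (countIoc l B (OwnedBy S c)) := by
    intro c
    by_cases hc : c = B
    · subst hc
      have h1 : countIoc l c (OwnedBy S c) = 0 := countIoc_eq_zero fun a _ _ ha => by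
        obtain ⟨⟨j, hj, h1, h2⟩, -⟩ := ha
        omega
      have h2 : countIoc A l (OwnedBy S c) = 0 := countIoc_eq_zero fun a _ _ ha => by
        obtain ⟨⟨j, hj, h1, h2⟩, -⟩ := ha
        omega
      rw [h1, h2, countIoc_succ, if_pos ((hlast' c).2 rfl)]
      simp
    · rw [countIoc_succ, if_neg (by rw [hlast']; exact hc), add_zero]
      apply catalan_add_of_eq_zero
      rw [hL2]
      rcases Nat.lt_or_ge c l with h1 | h1
      · right
        refine countIoc_eq_zero fun a h2 h3 ha => ?_
        rcases hl.eq_or_lt with h5 | h5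
        · have := ownedBy_restrictHooks (((hs.right_congr (.inl h5) h2 h3).2 c).1 ha)
          omega
        · rcases ((hs.right_special h5 hd h2 h3).2 c).1 ha with h6 | h6
          · have := ownedBy_restrictHooks h6
            omega
          · omega
      · left
        refine countIoc_eq_zero fun a h2 h3 ha => ?_
        have := ownedBy_restrictHooks ha
        omega
  unfold hookWeight
  rw [countIoc_split hl hlB]
  simp only [countIoc_split hl hlB (OwnedBy S _), hC]
  rw [Finset.prod_mul_distrib, hL1, countIoc_succ, if_neg hlast, add_zero]
  simp only [hL2]
  rcases hl.eq_or_lt with h5 | h5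
  · have hR1 : countIoc l B (IsBlue S) = countIoc l B (IsBlue (restrictHooks l B S)) :=
      countIoc_congr fun a h1 h2 => (hs.right_congr (.inl h5) h1 h2).1
    have hR2 : ∀ c, countIoc l B (OwnedBy S c) = countIoc l B (OwnedBy (restrictHooks l B S) c) :=
      fun c => countIoc_congr fun a h1 h2 => (hs.right_congr (.inl h5) h1 h2).2 c
    have h0 : countIoc A l (IsBlue (restrictHooks A l S)) = 0 :=
      countIoc_eq_zero fun a h1 h2 => by omega
    simp only [hR1, hR2, h0, zero_add, catalan_zero]
    ring
  · have hR1 : countIoc l B (IsBlue S) = 0 :=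
      countIoc_eq_zero fun a h1 h2 => (hs.right_special h5 hd h1 h2).1
    have hR2 : ∀ c, catalan (countIoc l B (OwnedBy S c)) =
        catalan (countIoc l B (OwnedBy (restrictHooks l B S) c)) *
          if c = l then catalan (countIoc l B (IsBlue (restrictHooks l B S))) else 1 := by
      intro c
      rw [countIoc_congr fun a h1 h2 => (hs.right_special h5 hd h1 h2).2 c]
      split_ifs with hc
      · rw [show countIoc l B (OwnedBy (restrictHooks l B S) c) = 0 from
          countIoc_eq_zero fun a h1 h2 ha => by have := ownedBy_restrictHooks ha; omega,
          catalan_zero, one_mul]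
        congr 1
        refine countIoc_congr fun a h1 h2 => ⟨?_, fun h => .inr ⟨hc, h⟩⟩
        rintro (h | h)
        · have := ownedBy_restrictHooks h
          omega
        · exact h.2
      · rw [mul_one]
        congr 1
        exact countIoc_congr fun a h1 h2 => by tauto
    simp only [hR1, hR2, add_zero, Finset.prod_mul_distrib]
    rw [Finset.prod_ite_eq' (Finset.range N) l, if_pos (by simp; omega)]
    ring

lemma SegVHC.prod_ownedBy_split (h : SegVHC e b A (B + 1) S) (hs : SplitsAt e A B l S)
    (hl : A ≤ l) (hlB : l ≤ B) (hd : ¬ SplitDesc e A B l) (hS : ∀ i, (i, B + 1) ∉ S) (N : ℕ) :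
    ∏ c ∈ Finset.range N, catalan (countIoc A (B + 1) (OwnedBy S c)) =
      (∏ c ∈ Finset.range N, catalan (countIoc A l (OwnedBy (restrictHooks A l S) c))) *
      ∏ c ∈ Finset.range N, catalan (countIoc l B (OwnedBy (restrictHooks l B S) c)) := by
  rw [← Finset.prod_mul_distrib]
  refine Finset.prod_congr rfl fun c _ => ?_
  rw [countIoc_split hl hlB, countIoc_succ, if_neg, add_zero,
    countIoc_congr fun a _ ha => (hs.left_congr hlB ha).2 c,
    countIoc_congr fun a h1 h2 => (hs.right_congr (.inr hd) h1 h2).2 c,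
    catalan_add_of_eq_zero (countIoc_ownedBy_eq_zero c S)]
  rintro ⟨⟨j, hj, h1, h2⟩, -⟩
  have := h.upper _ _ hj
  obtain rfl : j = B + 1 := by omega
  exact hS _ hj

lemma sum_card_filter_lt (s : Finset ℕ) (F : ℕ → ℕ) :
    ∑ x ∈ s, F ((s.filter (· < x)).card) = ∑ i ∈ Finset.range s.card, F i := by
  induction s using Finset.induction_on_max with
  | empty => simp
  | insert a s hs ih =>
    have ha : a ∉ s := fun h => lt_irrefl _ (hs a h)
    rw [Finset.sum_insert ha, Finset.card_insert_of_notMem ha, Finset.sum_range_succ, ← ih, add_comm]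
    congr 1
    · refine Finset.sum_congr rfl fun x hx => ?_
      rw [Finset.filter_insert, if_neg (by have := hs x hx; omega)]
    · rw [Finset.filter_insert, if_neg (by omega), Finset.filter_true_of_mem hs]

lemma catalan_succ_range (n : ℕ) :
    catalan (n + 1) = ∑ i ∈ Finset.range (n + 1), catalan i * catalan (n - i) := by
  rw [catalan_succ, Finset.sum_range (fun i => catalan i * catalan (n - i))]

open Classical in
lemma sum_catalan_split (hAB : A ≤ B) {p : ℕ → Prop} (hp : p (B + 1)) :
    ∑ l ∈ (Finset.Icc A B).filter (fun l => p (l + 1)),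
      catalan (countIoc A l p) * catalan (countIoc l B p) = catalan (countIoc A (B + 1) p) := by
  set s := (Finset.Ioc A (B + 1)).filter p with hsdef
  have hs : s.card = countIoc A B p + 1 := by
    change countIoc A (B + 1) p = _
    rw [countIoc_add hAB B.le_succ, countIoc_succ, if_pos hp]
  change _ = catalan s.card
  rw [hs, catalan_succ_range, ← hs,
    ← sum_card_filter_lt s (fun i => catalan i * catalan (countIoc A B p - i))]
  refine Finset.sum_bij (fun l _ => l + 1) ?_ ?_ ?_ ?_
  · intro l hl
    simp [hsdef] at hl ⊢
    exact ⟨by omega, hl.2⟩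
  · intro l _ l' _ h
    omega
  · intro x hx
    simp [hsdef] at hx
    refine ⟨x - 1, ?_, by omega⟩
    rw [Finset.mem_filter, Finset.mem_Icc, Nat.sub_add_cancel (by omega)]
    exact ⟨by omega, hx.2⟩
  · intro l hl
    simp only [Finset.mem_filter, Finset.mem_Icc] at hl
    have h1 : (s.filter (· < l + 1)).card = countIoc A l p := by
      unfold countIoc
      congr 1
      ext x
      simp [hsdef]
      grind
    rw [h1, countIoc_add hl.1.1 hl.1.2 p, Nat.add_sub_cancel_left]

open Classical in
lemma SegVHC.hookWeight_eq_sum (h : SegVHC e b A (B + 1) S) (hAB : A ≤ B) {N : ℕ} (hN : B < N) :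
    hookWeight N A (B + 1) S =
      ∑ l ∈ (Finset.Icc A B).filter (fun l => SplitRel e b A B l ∧ SplitsAt e A B l S),
        hookWeight N A l (restrictHooks A l S) * hookWeight N l B (restrictHooks l B S) := by
  by_cases hS : ∃ i, (i, B + 1) ∈ S
  · obtain ⟨i, hi⟩ := hS
    obtain ⟨l, hl, hlB, hd, hr, hs, huniq⟩ := h.exists_split hAB hi
    rw [show (Finset.Icc A B).filter (fun l => SplitRel e b A B l ∧ SplitsAt e A B l S) = {l} by
      ext l'
      simp only [Finset.mem_filter, Finset.mem_Icc, Finset.mem_singleton]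
      constructor
      · rintro ⟨⟨h1, h2⟩, h3, h4⟩
        exact huniq l' h1 h2 h3 h4
      · rintro rfl
        exact ⟨⟨hl, hlB⟩, hr, hs⟩, Finset.sum_singleton]
    exact h.hookWeight_special hs hl hlB hd hN
  · push Not at hS
    have hblue : IsBlue S (B + 1) := fun i j hij ⟨h1, h2⟩ => by
      have := h.upper _ _ hij
      obtain rfl : j = B + 1 := by omega
      exact hS _ hij
    rw [Finset.filter_congr (q := fun l => IsBlue S (l + 1)) (fun l hl => by
      rw [Finset.mem_Icc] at hl
      exact h.split_iff_isBlue hl.1 hl.2 hS)]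
    conv_lhs => rw [hookWeight, ← sum_catalan_split hAB hblue, Finset.sum_mul]
    refine Finset.sum_congr rfl fun l hl => ?_
    rw [Finset.mem_filter, Finset.mem_Icc] at hl
    obtain ⟨-, hs⟩ := (h.split_iff_isBlue hl.1.1 hl.1.2 hS).2 hl.2
    have hd : ¬ SplitDesc e A B l := by
      intro hd
      have : A < B := by rcases hd with h | h <;> omega
      exact hS B ((splitsAt_iff.1 hs _ _).2 (.inr (.inr ⟨.inr rfl, rfl, this, hd⟩)))
    rw [h.prod_ownedBy_split hs hl.1.1 hl.1.2 hd hS N,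
      countIoc_congr fun a _ ha => (hs.left_congr hl.1.2 ha).1,
      countIoc_congr fun a h1 h2 => (hs.right_congr (.inr hd) h1 h2).1]
    unfold hookWeight
    ring

open Classical in
/-- The valid hook configurations of `e (A+1), …, e B`. -/
noncomputable def segVHCs (e : ℕ → ℕ) (b : Bool) (N A B : ℕ) : Finset (Finset (ℕ × ℕ)) :=
  (Finset.range N ×ˢ Finset.range N).powerset.filter (SegVHC e b A B)

lemma mem_segVHCs {N : ℕ} (hN : B < N) : S ∈ segVHCs e b N A B ↔ SegVHC e b A B S := by
  classical
  simp only [segVHCs, Finset.mem_filter, Finset.mem_powerset, and_iff_right_iff_imp]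
  rintro h ⟨i, j⟩ hij
  have := h.lt _ _ hij
  have := h.upper _ _ hij
  simp
  omega

lemma SegVHC.restrictHooks_join (hlB : l ≤ B)
    (h₁ : SegVHC e b A l S₁) (h₂ : SegVHC e b l B S₂) :
    restrictHooks A l (S₁ ∪ S₂ ∪ newHooks e A B l) = S₁ ∧
      restrictHooks l B (S₁ ∪ S₂ ∪ newHooks e A B l) = S₂ := by
  have hb1 : ∀ i j, (i, j) ∈ S₁ → A < i ∧ i < j ∧ j ≤ l := fun i j h =>
    ⟨h₁.lower _ _ h, h₁.lt _ _ h, h₁.upper _ _ h⟩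
  have hb2 : ∀ i j, (i, j) ∈ S₂ → l < i ∧ i < j ∧ j ≤ B := fun i j h =>
    ⟨h₂.lower _ _ h, h₂.lt _ _ h, h₂.upper _ _ h⟩
  constructor
  all_goals
    ext ⟨i, j⟩
    rw [mem_restrictHooks, mem_joinHooks]
    grind

open Classical in
lemma sum_hookWeight_succ (hAB : A ≤ B) {N : ℕ} (hN : B + 1 < N) :
    ∑ S ∈ segVHCs e b N A (B + 1), hookWeight N A (B + 1) S =
      ∑ l ∈ (Finset.Icc A B).filter (SplitRel e b A B),
        (∑ S ∈ segVHCs e b N A l, hookWeight N A l S) *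
          ∑ S ∈ segVHCs e b N l B, hookWeight N l B S := by
  rw [Finset.sum_congr rfl fun S hS =>
    ((mem_segVHCs hN).1 hS).hookWeight_eq_sum hAB (N := N) (by omega)]
  rw [Finset.sum_comm' (t' := (Finset.Icc A B).filter (SplitRel e b A B))
    (s' := fun l => (segVHCs e b N A (B + 1)).filter (SplitsAt e A B l))
    (by simp only [Finset.mem_filter]; tauto)]
  refine Finset.sum_congr rfl fun l hl => ?_
  rw [Finset.mem_filter, Finset.mem_Icc] at hl
  obtain ⟨⟨hl, hlB⟩, hr⟩ := hl
  rw [Finset.sum_mul_sum, ← Finset.sum_product']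
  refine Finset.sum_bij' (fun S _ => (restrictHooks A l S, restrictHooks l B S))
    (fun P _ => P.1 ∪ P.2 ∪ newHooks e A B l) ?_ ?_ ?_ ?_ ?_
  · intro S hS
    rw [Finset.mem_filter, mem_segVHCs hN] at hS
    rw [Finset.mem_product, mem_segVHCs (by omega), mem_segVHCs (by omega)]
    exact hS.1.restrict hl hlB hS.2
  · rintro ⟨S₁, S₂⟩ hS
    rw [Finset.mem_product, mem_segVHCs (by omega), mem_segVHCs (by omega)] at hS
    rw [Finset.mem_filter, mem_segVHCs hN]
    refine ⟨hS.1.join hl hlB hr hS.2, ?_⟩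
    obtain ⟨h1, h2⟩ := hS.1.restrictHooks_join hlB hS.2
    unfold SplitsAt
    rw [h1, h2]
  · intro S hS
    rw [Finset.mem_filter] at hS
    exact hS.2.symm
  · rintro ⟨S₁, S₂⟩ hS
    rw [Finset.mem_product, mem_segVHCs (by omega), mem_segVHCs (by omega)] at hS
    obtain ⟨h1, h2⟩ := hS.1.restrictHooks_join hlB hS.2
    simp only [h1, h2]
  · intro S _
    rfl

lemma sum_hookWeight_self {N : ℕ} (hN : A < N) :
    ∑ S ∈ segVHCs e b N A A, hookWeight N A A S = 1 := by
  have hemp : ∀ S, SegVHC e b A A S ↔ S = ∅ := by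
    intro S
    constructor
    · intro h
      rw [Finset.eq_empty_iff_forall_notMem]
      rintro ⟨i, j⟩ hij
      have := h.lower _ _ hij
      have := h.lt _ _ hij
      have := h.upper _ _ hij
      omega
    · rintro rfl
      constructor <;> simp
      omega
  rw [show segVHCs e b N A A = {∅} by ext S; rw [mem_segVHCs hN, hemp, Finset.mem_singleton],
    Finset.sum_singleton]
  simp [hookWeight, countIoc]

end SegVHC

section Preimages

variable {b : Bool}

lemma exists_parent_decomposition (b : Bool) {u : List ℕ} (hu : u ≠ []) :
    ∃ x n y, u = x ++ n :: y ∧ (∀ a ∈ x, LeftRel b a n) ∧ ∀ a ∈ y, RightRel b a n := by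
  obtain ⟨n, hmem, hle⟩ : ∃ n ∈ u, ∀ a ∈ u, a ≤ n :=
    ⟨_, foldr_max_mem hu, fun a ha => List.le_max_of_le ha le_rfl⟩
  cases b
  · obtain ⟨x, y, hxy, hx⟩ := List.eq_append_cons_of_mem (List.mem_reverse.2 hmem)
    have hu' : u = y.reverse ++ n :: x.reverse := by
      rw [← u.reverse_reverse, hxy]; simp
    refine ⟨_, n, _, hu', fun a ha => ?_, fun a ha => ?_⟩
    · exact hle a (by rw [hu']; simp_all)
    · exact lt_of_le_of_ne (hle a (by rw [hu']; simp_all)) (by rintro rfl; simp_all)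
  · obtain ⟨x, y, hxy, hx⟩ := List.eq_append_cons_of_mem hmem
    refine ⟨x, n, y, hxy, fun a ha => ?_, fun a ha => ?_⟩
    · exact lt_of_le_of_ne (hle a (by rw [hxy]; simp [ha])) (by rintro rfl; simp_all)
    · exact hle a (by rw [hxy]; simp [ha])

lemma append_cons_inj_of_notMem_left {x x' y y' : List ℕ} {n : ℕ} (hx : n ∉ x) (hx' : n ∉ x')
    (h : x ++ n :: y = x' ++ n :: y') : x = x' ∧ y = y' := by
  have h1 := congrArg (List.idxOf n) h
  rw [List.idxOf_append_of_notMem hx, List.idxOf_append_of_notMem hx'] at h1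
  simp only [List.idxOf_cons_self, add_zero] at h1
  obtain ⟨h2, h3⟩ := List.append_inj h h1
  exact ⟨h2, (List.cons.inj h3).2⟩

lemma parent_decomposition_unique {x x' y y' : List ℕ} {n : ℕ}
    (hx : ∀ a ∈ x, LeftRel b a n) (hx' : ∀ a ∈ x', LeftRel b a n)
    (hy : ∀ a ∈ y, RightRel b a n) (hy' : ∀ a ∈ y', RightRel b a n)
    (h : x ++ n :: y = x' ++ n :: y') : x = x' ∧ y = y' := by
  cases b
  · have h1 : n ∉ y := fun h => lt_irrefl n (hy n h)
    have h2 : n ∉ y' := fun h => lt_irrefl n (hy' n h)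
    have h3 := append_cons_inj_of_notMem_left (x := y.reverse) (x' := y'.reverse) (n := n)
      (y := x.reverse) (y' := x'.reverse) (by simpa) (by simpa)
      (by simpa using congrArg List.reverse h)
    simpa [and_comm] using h3
  · exact append_cons_inj_of_notMem_left (fun h => lt_irrefl n (hx n h))
      (fun h => lt_irrefl n (hx' n h)) h

/-- A postorder reading of the decreasing binary plane tree of a word. -/
structure IsTreeSort (b : Bool) (s : List ℕ → List ℕ) : Prop where
  nil : s [] = []
  node : ∀ x n y, (∀ a ∈ x, LeftRel b a n) → (∀ a ∈ y, RightRel b a n) →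
    s (x ++ n :: y) = s x ++ s y ++ [n]

lemma IsTreeSort.perm {s : List ℕ → List ℕ} (hs : IsTreeSort b s) (u : List ℕ) :
    (s u).Perm u := by
  induction hk : u.length using Nat.strong_induction_on generalizing u with
  | _ k ih =>
    rcases eq_or_ne u [] with rfl | hu
    · rw [hs.nil]
    · obtain ⟨x, n, y, rfl, hx, hy⟩ := exists_parent_decomposition b hu
      rw [hs.node x n y hx hy]
      simp only [List.length_append, List.length_cons] at hk
      have h1 := ih _ (by omega) x rfl
      have h2 := ih _ (by omega) y rfl
      rw [List.append_assoc]
      exact h1.append ((List.perm_append_singleton _ _).trans (h2.cons n))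

/-- The word `e (A+1), …, e B`. -/
def segWord (e : ℕ → ℕ) (A B : ℕ) : List ℕ := (List.range' (A + 1) (B - A)).map e

variable {e : ℕ → ℕ} {A B l : ℕ}

lemma length_segWord : (segWord e A B).length = B - A := by simp [segWord]

lemma segWord_self : segWord e A A = [] := by simp [segWord]

lemma segWord_append (hl : A ≤ l) (hlB : l ≤ B) :
    segWord e A B = segWord e A l ++ segWord e l B := by
  unfold segWord
  rw [← List.map_append, show B - A = (l - A) + (B - l) by omega, ← List.range'_append_1,
    show A + 1 + (l - A) = l + 1 by omega]

lemma segWord_succ (hAB : A ≤ B) : segWord e A (B + 1) = segWord e A B ++ [e (B + 1)] := by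
  rw [segWord_append hAB B.le_succ]
  simp [segWord]

lemma mem_segWord {x : ℕ} : x ∈ segWord e A B ↔ ∃ a, A < a ∧ a ≤ B ∧ e a = x := by
  simp only [segWord, List.mem_map, List.mem_range'_1]
  constructor
  · rintro ⟨a, h, h'⟩
    exact ⟨a, by omega, by omega, h'⟩
  · rintro ⟨a, h, h', h''⟩
    exact ⟨a, by omega, h''⟩

lemma IsTreeSort.splitRel_iff {s : List ℕ → List ℕ} (hs : IsTreeSort b s) {x y : List ℕ}
    (hx : s x = segWord e A l) (hy : s y = segWord e l B) :
    SplitRel e b A B l ↔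
      (∀ a ∈ x, LeftRel b a (e (B + 1))) ∧ ∀ a ∈ y, RightRel b a (e (B + 1)) := by
  simp only [← (hs.perm x).mem_iff, ← (hs.perm y).mem_iff, hx, hy, mem_segWord, SplitRel]
  grind

open Classical in
lemma IsTreeSort.exists_preimages {s : List ℕ → List ℕ} (hs : IsTreeSort b s) (N : ℕ)
    (hAB : A ≤ B) (hN : B < N) :
    ∃ P : Finset (List ℕ), (∀ u, u ∈ P ↔ s u = segWord e A B) ∧
      P.card = ∑ S ∈ segVHCs e b N A B, hookWeight N A B S := by
  induction hk : B - A using Nat.strong_induction_on generalizing A B with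
  | _ k ih =>
    rcases hAB.eq_or_lt with rfl | hlt
    · refine ⟨{[]}, fun u => ?_, ?_⟩
      · rw [segWord_self, Finset.mem_singleton]
        constructor
        · rintro rfl
          exact hs.nil
        · intro h
          have := hs.perm u
          rw [h] at this
          exact List.nil_perm.1 this
      · rw [sum_hookWeight_self hN, Finset.card_singleton]
    · obtain ⟨B, rfl⟩ : ∃ B', B = B' + 1 := ⟨B - 1, by omega⟩
      have hAB' : A ≤ B := by omega
      have ih' : ∀ A' B', A ≤ A' → B' ≤ B → ∃ P : Finset (List ℕ), A' ≤ B' →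
          (∀ u, u ∈ P ↔ s u = segWord e A' B') ∧
            P.card = ∑ S ∈ segVHCs e b N A' B', hookWeight N A' B' S := by
        intro A' B' h1 h2
        by_cases h : A' ≤ B'
        · obtain ⟨P, hP⟩ := ih (B' - A') (by omega) h (by omega) rfl
          exact ⟨P, fun _ => hP⟩
        · exact ⟨∅, fun h' => absurd h' h⟩
      choose! P hP using ih'
      let Q : ℕ → Finset (List ℕ) := fun l =>
        (P A l ×ˢ P l B).image fun z => z.1 ++ e (B + 1) :: z.2
      have hQ : ∀ l, A ≤ l → l ≤ B → ∀ u, u ∈ Q l ↔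
          ∃ x y, s x = segWord e A l ∧ s y = segWord e l B ∧ x ++ e (B + 1) :: y = u := by
        intro l h1 h2 u
        simp only [Q, Finset.mem_image, Finset.mem_product, Prod.exists,
          (hP A l le_rfl h2 h1).1, (hP l B h1 le_rfl h2).1, and_assoc]
      have hinj : ∀ l l', A ≤ l → l ≤ B → A ≤ l' → l' ≤ B → SplitRel e b A B l →
          SplitRel e b A B l' → ∀ x y x' y', s x = segWord e A l → s y = segWord e l B →
          s x' = segWord e A l' → s y' = segWord e l' B →
          x ++ e (B + 1) :: y = x' ++ e (B + 1) :: y' → x = x' ∧ y = y' := by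
        intro l l' _ _ _ _ hr hr' x y x' y' hx hy hx' hy' h
        rw [hs.splitRel_iff hx hy] at hr
        rw [hs.splitRel_iff hx' hy'] at hr'
        exact parent_decomposition_unique hr.1 hr'.1 hr.2 hr'.2 h
      refine ⟨((Finset.Icc A B).filter (SplitRel e b A B)).biUnion Q, fun u => ?_, ?_⟩
      · simp only [Finset.mem_biUnion, Finset.mem_filter, Finset.mem_Icc]
        rw [segWord_succ hAB']
        constructor
        · rintro ⟨l, ⟨⟨h1, h2⟩, hr⟩, hu⟩
          obtain ⟨x, y, hx, hy, rfl⟩ := (hQ l h1 h2 u).1 hu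
          rw [hs.splitRel_iff hx hy] at hr
          rw [hs.node _ _ _ hr.1 hr.2, hx, hy, ← segWord_append h1 h2]
        · intro hu
          have hne : u ≠ [] := by
            rintro rfl
            rw [hs.nil] at hu
            simp at hu
          obtain ⟨x, n, y, rfl, hx, hy⟩ := exists_parent_decomposition b hne
          rw [hs.node x n y hx hy] at hu
          obtain ⟨h1, h2⟩ := List.append_inj' hu rfl
          obtain rfl : n = e (B + 1) := by simpa using h2
          have hlen := congrArg List.length h1
          rw [List.length_append, length_segWord] at hlen
          have hl : A ≤ A + (s x).length := by omega
          have hlB : A + (s x).length ≤ B := by omega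
          rw [segWord_append hl hlB] at h1
          obtain ⟨h3, h4⟩ := List.append_inj h1 (by rw [length_segWord]; omega)
          exact ⟨_, ⟨⟨hl, hlB⟩, (hs.splitRel_iff h3 h4).2 ⟨hx, hy⟩⟩,
            (hQ _ hl hlB _).2 ⟨x, y, h3, h4, rfl⟩⟩
      · rw [sum_hookWeight_succ hAB' hN, Finset.card_biUnion]
        · refine Finset.sum_congr rfl fun l hl => ?_
          rw [Finset.mem_filter, Finset.mem_Icc] at hl
          obtain ⟨⟨h1, h2⟩, hr⟩ := hl
          rw [← (hP A l le_rfl h2 h1).2, ← (hP l B h1 le_rfl h2).2, ← Finset.card_product]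
          apply Finset.card_image_of_injOn
          rintro ⟨x, y⟩ hz ⟨x', y'⟩ hz' h
          simp only [Finset.coe_product, Set.mem_prod, Finset.mem_coe,
            (hP A l le_rfl h2 h1).1, (hP l B h1 le_rfl h2).1] at hz hz'
          exact Prod.ext_iff.2 (hinj l l h1 h2 h1 h2 hr hr _ _ _ _ hz.1 hz.2 hz'.1 hz'.2 h)
        · intro l hl l' hl' hne
          simp only [Finset.coe_filter, Set.mem_ofPred_eq, Finset.mem_Icc] at hl hl'
          rw [Function.onFun, Finset.disjoint_left]
          intro u hu hu'
          obtain ⟨x, y, hx, hy, rfl⟩ := (hQ l hl.1.1 hl.1.2 u).1 hu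
          obtain ⟨x', y', hx', hy', h⟩ := (hQ l' hl'.1.1 hl'.1.2 _).1 hu'
          obtain ⟨rfl, rfl⟩ := hinj l' l hl'.1.1 hl'.1.2 hl.1.1 hl.1.2 hl'.2 hl.2 _ _ _ _
            hx' hy' hx hy h
          have := congrArg List.length (hx.symm.trans hx')
          rw [length_segWord, length_segWord] at this
          omega

lemma foldr_max_eq {u : List ℕ} {n : ℕ} (hn : n ∈ u) (hu : ∀ a ∈ u, a ≤ n) :
    u.foldr max 0 = n :=
  le_antisymm (hu _ (foldr_max_mem (List.ne_nil_of_mem hn))) (List.le_max_of_le hn le_rfl)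

lemma blocks_of_notMem {n : ℕ} {u : List ℕ} (h : n ∉ u) : blocks n u = [u] := by
  induction u with
  | nil => rfl
  | cons a u ih =>
    simp only [List.mem_cons, not_or] at h
    rw [blocks, if_neg (Ne.symm h.1), ih h.2]
    rfl

lemma blocks_append_cons_of_notMem_left {n : ℕ} {x : List ℕ} (h : n ∉ x) (y : List ℕ) :
    blocks n (x ++ n :: y) = x :: blocks n y := by
  induction x with
  | nil => simp [blocks]
  | cons a x ih =>
    simp only [List.mem_cons, not_or] at h
    rw [List.cons_append, blocks, if_neg (Ne.symm h.1), ih h.2]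
    rfl

lemma blocks_append_cons_of_notMem_right {n : ℕ} {y : List ℕ} (h : n ∉ y) (x : List ℕ) :
    blocks n (x ++ n :: y) = blocks n x ++ [y] := by
  induction x with
  | nil => simp [blocks, blocks_of_notMem h]
  | cons a x ih =>
    rw [List.cons_append, blocks, blocks, ih]
    split_ifs
    · rfl
    · obtain ⟨z, zs, hz⟩ := List.exists_cons_of_ne_nil (blocks_ne_nil n x)
      simp [hz]

lemma fast_eq_of_le {n : ℕ} {u : List ℕ} (hu : ∀ a ∈ u, a ≤ n) :
    fast u = ((blocks n u).map fast).flatten ++ List.replicate (u.count n) n := by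
  by_cases hn : n ∈ u
  · conv_lhs => rw [fast, dif_neg (List.ne_nil_of_mem hn)]
    simp only [foldr_max_eq hn hu]
    rw [List.attach_map_val (f := fast), foldr_max_eq hn hu]
  · rw [blocks_of_notMem hn, List.count_eq_zero.2 hn]
    simp

lemma slow_eq_of_le {n : ℕ} {u : List ℕ} (hu : ∀ a ∈ u, a ≤ n) :
    slow u = slow (blocks n u).headI ++ ((blocks n u).tail.map fun x => slow x ++ [n]).flatten := by
  by_cases hn : n ∈ u
  · conv_lhs => rw [slow, dif_neg (List.ne_nil_of_mem hn)]
    simp only [foldr_max_eq hn hu]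
    rw [List.attach_map_val (f := fun x => slow x ++ [n]), foldr_max_eq hn hu]
  · rw [blocks_of_notMem hn]
    simp

lemma isTreeSort_fast : IsTreeSort true fast := by
  refine ⟨by rw [fast, dif_pos rfl], fun x n y hx hy => ?_⟩
  have hx' : n ∉ x := fun h => lt_irrefl n (hx n h)
  have hle : ∀ a ∈ x ++ n :: y, a ≤ n := by
    intro a ha
    rw [List.mem_append, List.mem_cons] at ha
    rcases ha with h | rfl | h
    · exact (show a < n from hx a h).le
    · rfl
    · exact hy a h
  rw [fast_eq_of_le hle, fast_eq_of_le (n := n) hy, blocks_append_cons_of_notMem_left hx',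
    List.count_append, List.count_eq_zero.2 hx', List.count_cons_self, zero_add,
    List.replicate_succ']
  simp

lemma isTreeSort_slow : IsTreeSort false slow := by
  refine ⟨by rw [slow, dif_pos rfl], fun x n y hx hy => ?_⟩
  have hy' : n ∉ y := fun h => lt_irrefl n (hy n h)
  have hle : ∀ a ∈ x ++ n :: y, a ≤ n := by
    intro a ha
    rw [List.mem_append, List.mem_cons] at ha
    rcases ha with h | rfl | h
    · exact hx a h
    · rfl
    · exact (show a < n from hy a h).le
  rw [slow_eq_of_le hle, slow_eq_of_le (n := n) hx, blocks_append_cons_of_notMem_right hy']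
  obtain ⟨z, zs, hz⟩ := List.exists_cons_of_ne_nil (blocks_ne_nil n x)
  simp [hz]

end Preimages

section ListConfigurations

variable {w : List ℕ} {H : List (ℕ × ℕ)} {b : Bool}

lemma SegVHC.seesHook_iff (h : SegVHC (entry w) b 0 w.length H.toFinset) {x : ℕ × ℕ}
    (hx : x ∈ H) {a : ℕ} : seesHook w x a ↔ x.1 < a ∧ a ≤ x.2 := by
  obtain ⟨i, j⟩ := x
  have hx' : (i, j) ∈ H.toFinset := List.mem_toFinset.2 hx
  have := h.lt _ _ hx'
  have hle : i < a → a ≤ j → _ := h.le_of_below hx'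
  simp only [seesHook]
  constructor
  · omega
  · rintro ⟨h1, h2⟩
    have := hle h1 h2
    omega

lemma SegVHC.colorOf_eq_zero_iff (h : SegVHC (entry w) b 0 w.length H.toFinset) {a : ℕ} :
    colorOf w H a = 0 ↔ IsBlue H.toFinset a := by
  unfold colorOf IsBlue
  rw [← Nat.bot_eq_zero, Finset.sup_eq_bot_iff]
  simp only [Finset.mem_filter, Finset.mem_range, Nat.bot_eq_zero, Nat.succ_ne_zero, imp_false,
    not_and, List.mem_toFinset]
  constructor
  · intro h' i j hij h1 h2
    obtain ⟨u, hu, hu'⟩ := List.mem_iff_getElem.1 hij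
    refine h' u hu ?_
    rw [List.getD_eq_getElem _ _ hu, hu', h.seesHook_iff hij]
    exact ⟨h1, h2⟩
  · intro h' u hu hs
    have hm := List.getElem_mem hu
    rw [List.getD_eq_getElem _ _ hu, h.seesHook_iff hm] at hs
    exact h' _ _ hm hs.1 hs.2

lemma SegVHC.colorOf_eq_succ_iff (h : SegVHC (entry w) b 0 w.length H.toFinset)
    (hH : (H.map Prod.fst).Pairwise (· < ·)) {u : ℕ} (hu : u < H.length) {a : ℕ} :
    colorOf w H a = u + 1 ↔ OwnedBy H.toFinset H[u].1 a := by
  have hlt : ∀ v v' (hv : v < H.length) (hv' : v' < H.length), v < v' → H[v].1 < H[v'].1 := by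
    rw [List.pairwise_map, List.pairwise_iff_getElem] at hH
    exact hH
  have hsees : ∀ v (hv : v < H.length), seesHook w (H.getD v (0, 0)) a ↔
      H[v].1 < a ∧ a ≤ H[v].2 := by
    intro v hv
    rw [List.getD_eq_getElem _ _ hv, h.seesHook_iff (List.getElem_mem hv)]
  have hcol : colorOf w H a = u + 1 ↔ seesHook w (H.getD u (0, 0)) a ∧
      ∀ v, v < H.length → seesHook w (H.getD v (0, 0)) a → v ≤ u := by
    unfold colorOf
    set s := (Finset.range H.length).filter fun v => seesHook w (H.getD v (0, 0)) a with hs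
    constructor
    · intro heq
      have hne : s.Nonempty := by
        by_contra hne
        rw [Finset.not_nonempty_iff_eq_empty.1 hne] at heq
        simp at heq
      obtain ⟨v, hv, hv'⟩ := Finset.exists_mem_eq_sup s hne (· + 1)
      obtain rfl : u = v := by omega
      refine ⟨(Finset.mem_filter.1 hv).2, fun v' h1 h2 => ?_⟩
      have := Finset.le_sup (f := (· + 1))
        (show v' ∈ s from Finset.mem_filter.2 ⟨Finset.mem_range.2 h1, h2⟩)
      omega
    · rintro ⟨h1, h2⟩
      apply le_antisymm
      · refine Finset.sup_le fun v hv => ?_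
        rw [Finset.mem_filter, Finset.mem_range] at hv
        have := h2 v hv.1 hv.2
        omega
      · exact Finset.le_sup (f := (· + 1))
          (show u ∈ s from Finset.mem_filter.2 ⟨Finset.mem_range.2 hu, h1⟩)
  rw [hcol, hsees u hu]
  unfold OwnedBy
  constructor
  · rintro ⟨h1, h2⟩
    refine ⟨⟨H[u].2, List.mem_toFinset.2 (List.getElem_mem hu), h1⟩, fun i j hij h3 h4 => ?_⟩
    obtain ⟨v, hv, hv'⟩ := List.mem_iff_getElem.1 (List.mem_toFinset.1 hij)
    have h5 := h2 v hv ((hsees v hv).2 (by rw [hv']; exact ⟨h3, h4⟩))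
    rcases h5.eq_or_lt with rfl | h5
    · rw [hv']
    · have := hlt v u hv hu h5
      rw [hv'] at this
      exact this.le
  · rintro ⟨⟨j, hj, h1, h2⟩, h3⟩
    have hj' : j = H[u].2 :=
      h.inj _ _ _ hj (List.mem_toFinset.2 (List.getElem_mem hu))
    refine ⟨⟨h1, hj' ▸ h2⟩, fun v hv hs => ?_⟩
    have hs' := (hsees v hv).1 hs
    have h4 : H[v].1 ≤ H[u].1 :=
      h3 H[v].1 H[v].2 (List.mem_toFinset.2 (List.getElem_mem hv)) hs'.1 hs'.2
    by_contra hc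
    have h5 : H[u].1 < H[v].1 := hlt u v hu hv (by omega)
    omega

lemma SegVHC.catComp_eq (h : SegVHC (entry w) b 0 w.length H.toFinset)
    (hH : (H.map Prod.fst).Pairwise (· < ·)) :
    CatComp w H = hookWeight (w.length + 1) 0 w.length H.toFinset := by
  classical
  unfold CatComp hookWeight
  rw [Finset.prod_range_succ', mul_comm]
  congr 1
  · unfold countIoc
    exact congrArg (fun s => catalan (Finset.card s)) (Finset.filter_congr fun a _ => h.colorOf_eq_zero_iff)
  · have hmem : ∀ u (hu : u < H.length), (H[u].1, H[u].2) ∈ H.toFinset := fun u hu =>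
      List.mem_toFinset.2 (List.getElem_mem hu)
    refine Finset.prod_of_injOn (fun u => (H.getD u (0, 0)).1) ?_ ?_ ?_ ?_
    · intro u hu v hv huv
      simp only [Finset.coe_range, Set.mem_Iio] at hu hv
      simp only [List.getD_eq_getElem _ _ hu, List.getD_eq_getElem _ _ hv] at huv
      rw [List.pairwise_map, List.pairwise_iff_getElem] at hH
      rcases lt_trichotomy u v with h1 | h1 | h1
      · have := hH u v hu hv h1; omega
      · exact h1
      · have := hH v u hv hu h1; omega
    · intro u hu
      simp only [Finset.coe_range, Set.mem_Iio] at hu ⊢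
      simp only [List.getD_eq_getElem _ _ hu]
      have := h.lt _ _ (hmem u hu)
      have := h.upper _ _ (hmem u hu)
      omega
    · intro c _ hc
      rw [countIoc_eq_zero, catalan_zero]
      rintro a - - ⟨⟨j, hj, -⟩, -⟩
      obtain ⟨u, hu, hu'⟩ := List.mem_iff_getElem.1 (List.mem_toFinset.1 hj)
      refine hc ⟨u, by simpa using hu, ?_⟩
      simp only [List.getD_eq_getElem _ _ hu, hu']
    · intro u hu
      rw [Finset.mem_range] at hu
      simp only [List.getD_eq_getElem _ _ hu]
      unfold countIoc
      exact congrArg (fun s => catalan (Finset.card s))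
        (Finset.filter_congr fun a _ => h.colorOf_eq_succ_iff hH hu)

lemma isBinaryVHC_iff : (IsBinaryVHC w H ∧ ∀ i j, (i, j + 1) ∈ H → i < j →
      LeftRel b (entry w i) (entry w (j + 1)) ∧ RightRel b (entry w j) (entry w (j + 1))) ↔
    (H.map Prod.fst).Pairwise (· < ·) ∧ SegVHC (entry w) b 0 w.length H.toFinset := by
  have hcount : ∀ j, H.Nodup → H.countP (fun h => h.2 == j) =
      (H.toFinset.filter fun h => h.2 = j).card := by
    intro j hnd
    rw [List.countP_eq_length_filter, ← List.toFinset_card_of_nodup (hnd.filter _),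
      List.toFinset_filter]
    simp
  have hnd : (H.map Prod.fst).Pairwise (· < ·) → (H.map Prod.fst).Nodup :=
    fun h => h.imp fun h => h.ne
  constructor
  · rintro ⟨⟨⟨hhook, hsort, hdesc, hne, hcross⟩, hbin⟩, hrel⟩
    have hinj : ∀ i j j', (i, j) ∈ H → (i, j') ∈ H → j = j' := fun i j j' hj hj' =>
      congrArg Prod.snd (List.inj_on_of_nodup_map (hnd hsort) hj hj' rfl)
    have hsmall : ∀ i j, (i, j + 1) ∈ H → (j, j + 1) ∈ H := by
      intro i j hij
      obtain ⟨-, ⟨i', j'⟩, h1, h2, h3⟩ := hne (j + 1) ⟨_, hij, rfl⟩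
      simp only at h2 h3
      obtain rfl : i' = j := by omega
      rwa [h2] at h1
    refine ⟨hsort, ?_⟩
    constructor <;> simp only [List.mem_toFinset]
    · exact fun i j hij => (hhook _ hij).1
    · exact fun i j hij => (hhook _ hij).2.1
    · exact fun i j hij => (hhook _ hij).2.2.1
    · exact fun i j hij => (hhook _ hij).2.2.2
    · exact hinj
    · intro d h1 h2 h3
      obtain ⟨⟨i, j⟩, hij, rfl⟩ := hdesc d ⟨h1, h2, h3⟩
      exact ⟨j, hij⟩
    · exact hsmall
    · intro i j hij
      obtain ⟨⟨⟨d, j'⟩, h1, rfl, h2⟩, -⟩ := hne j ⟨_, hij, rfl⟩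
      exact ⟨d, h1, h2.2.2⟩
    · intro i j i' j' hij hij' h1 h2
      by_contra hj
      rcases Nat.lt_or_ge (i' + 1) j with h3 | h3
      · rcases hcross _ hij _ hij' with h | h | h
        · have : i' + 1 ∈ (∅ : Set ℕ) := by
            rw [← h]
            exact ⟨⟨by simp only; omega, h3⟩, ⟨by simp, by simp only; omega⟩⟩
          exact this
        · have := h (show i' ∈ Set.Ioo i j from ⟨h1, h2⟩)
          exact lt_irrefl _ this.1
        · have := h (show j ∈ Set.Ioo i' j' from ⟨h2, by omega⟩)
          exact lt_irrefl _ this.2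
      · obtain rfl : j = i' + 1 := by omega
        have := hinj _ _ _ hij' (hsmall _ _ hij)
        omega
    · intro i i' j hij hij' h1 h2
      by_contra hii
      obtain ⟨k, rfl⟩ : ∃ k, j = k + 1 := ⟨j - 1, by omega⟩
      have h3 : ({(i, k + 1), (i', k + 1), (k, k + 1)} : Finset (ℕ × ℕ)).card = 3 := by
        rw [Finset.card_eq_three]
        refine ⟨_, _, _, ?_, ?_, ?_, rfl⟩ <;> simp <;> omega
      have h4 := hbin (k + 1)
      rw [hcount _ (hnd hsort).of_map] at h4
      have h5 : ({(i, k + 1), (i', k + 1), (k, k + 1)} : Finset (ℕ × ℕ)) ⊆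
          H.toFinset.filter fun h => h.2 = k + 1 := by
        intro x hx
        simp only [Finset.mem_insert, Finset.mem_singleton] at hx
        rw [Finset.mem_filter, List.mem_toFinset]
        have := hsmall _ _ hij
        rcases hx with rfl | rfl | rfl <;> simp [*]
      have := Finset.card_le_card h5
      omega
    · exact hrel
  · rintro ⟨hsort, h⟩
    have hm : ∀ {i j}, (i, j) ∈ H ↔ (i, j) ∈ H.toFinset := List.mem_toFinset.symm
    refine ⟨⟨⟨?_, hsort, ?_, ?_, ?_⟩, ?_⟩, fun i j hij => h.rel i j (hm.1 hij)⟩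
    · rintro ⟨i, j⟩ hij
      rw [hm] at hij
      exact ⟨h.lower _ _ hij, h.lt _ _ hij, h.upper _ _ hij, h.le _ _ hij⟩
    · rintro d ⟨h1, h2, h3⟩
      obtain ⟨j, hj⟩ := h.desc d h1 h2 h3
      exact ⟨_, hm.2 hj, rfl⟩
    · rintro j ⟨⟨i, j⟩, hij, rfl⟩
      rw [hm] at hij
      constructor
      · obtain ⟨d, hd, hd'⟩ := h.descHook _ _ hij
        have h1 := h.lt _ _ hd
        have h2 := h.upper _ _ hd
        exact ⟨_, hm.2 hd, rfl, h.lower _ _ hd, by simp only; omega, hd'⟩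
      · obtain ⟨k, rfl⟩ : ∃ k, j = k + 1 := ⟨j - 1, by have := h.lt _ _ hij; omega⟩
        exact ⟨_, hm.2 (h.small _ _ hij), rfl, rfl⟩
    · rintro ⟨i, j⟩ hij ⟨i', j'⟩ hij'
      rw [hm] at hij hij'
      have key : ∀ i j i' j', (i, j) ∈ H.toFinset → (i', j') ∈ H.toFinset → i < i' →
          (Set.Ioo i j : Set ℕ) ∩ Set.Ioo i' j' = ∅ ∨
            (Set.Ioo i' j' : Set ℕ) ⊆ Set.Ioo i j := by
        intro i j i' j' hij hij' hii
        rcases Nat.lt_or_ge i' j with hi | hi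
        · right
          exact Set.Ioo_subset_Ioo hii.le (h.noncrossing _ _ _ _ hij hij' hii hi)
        · left
          rw [Set.eq_empty_iff_forall_notMem]
          rintro x ⟨⟨h1, h2⟩, ⟨h3, h4⟩⟩
          omega
      rcases lt_trichotomy i i' with hi | rfl | hi
      · have := key _ _ _ _ hij hij' hi
        simp only
        tauto
      · rw [h.inj _ _ _ hij hij']
        exact .inr (.inl subset_rfl)
      · have := key _ _ _ _ hij' hij hi
        simp only
        rw [Set.inter_comm]
        tauto
    · intro j
      rw [hcount j (hnd hsort).of_map]
      by_cases hex : ∃ i, (i, j) ∈ H.toFinset ∧ i + 1 < j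
      · obtain ⟨i, hi, hij⟩ := hex
        refine (Finset.card_le_card (t := {(i, j), (j - 1, j)}) ?_).trans Finset.card_le_two
        rintro ⟨i', j'⟩ hx
        rw [Finset.mem_filter] at hx
        obtain ⟨hx, rfl⟩ := hx
        have := h.lt _ _ hx
        have := h.binary _ _ _ hx hi
        simp
        omega
      · push Not at hex
        refine (Finset.card_le_card (t := {(j - 1, j)}) ?_).trans (by simp)
        rintro ⟨i', j'⟩ hx
        rw [Finset.mem_filter] at hx
        obtain ⟨hx, rfl⟩ := hx
        have := h.lt _ _ hx
        have := hex _ hx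
        simp
        omega

lemma mem_HR_iff : H ∈ HR w ↔
    (H.map Prod.fst).Pairwise (· < ·) ∧ SegVHC (entry w) true 0 w.length H.toFinset := by
  rw [← isBinaryVHC_iff]
  refine and_congr_right fun hH => ⟨fun h i j hij hlt => ?_, fun h => ?_⟩
  · obtain ⟨-, ⟨i', j'⟩, h1, h2, h3⟩ := hH.1.2.2.2.1 (j + 1) ⟨_, hij, rfl⟩
    have hle := (hH.1.1 _ hij).2.2.2
    simp only at h2 h3 hle
    obtain rfl : i' = j := by omega
    subst h2
    refine ⟨lt_of_le_of_ne hle fun heq => ?_, (hH.1.1 _ h1).2.2.2⟩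
    have := h _ hij heq
    simp only at this
    omega
  · rintro ⟨i, j⟩ hij heq
    by_contra hne
    have hlt := (hH.1.1 _ hij).2.1
    simp only at heq hne hlt
    obtain ⟨k, rfl⟩ : ∃ k, j = k + 1 := ⟨j - 1, by omega⟩
    have : entry w i < entry w (k + 1) := (h i k hij (by omega)).1
    omega

lemma mem_HL_iff : H ∈ HL w ↔
    (H.map Prod.fst).Pairwise (· < ·) ∧ SegVHC (entry w) false 0 w.length H.toFinset := by
  rw [← isBinaryVHC_iff]
  refine and_congr_right fun hH => ⟨fun h i j hij hlt => ?_, fun h => ?_⟩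
  · obtain ⟨-, ⟨i', j'⟩, h1, h2, h3⟩ := hH.1.2.2.2.1 (j + 1) ⟨_, hij, rfl⟩
    simp only at h2 h3
    obtain rfl : i' = j := by omega
    subst h2
    refine ⟨(hH.1.1 _ hij).2.2.2, lt_of_le_of_ne (hH.1.1 _ h1).2.2.2 fun heq => ?_⟩
    exact h _ h1 rfl heq _ hij (by simp; omega) rfl
  · rintro ⟨i, j⟩ hij hsm heq ⟨i', j'⟩ hij' hne rfl
    have hlt := (hH.1.1 _ hij').2.1
    simp only [ne_eq, Prod.mk.injEq, and_true] at heq hsm hne hlt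
    subst hsm
    have : entry w i < entry w (i + 1) := (h i' i hij' (by omega)).2
    omega

lemma exists_sorted_list (S : Finset (ℕ × ℕ))
    (hS : ∀ i j j', (i, j) ∈ S → (i, j') ∈ S → j = j') :
    ∃ H : List (ℕ × ℕ), (H.map Prod.fst).Pairwise (· < ·) ∧ H.toFinset = S := by
  revert hS
  refine Finset.induction_on_max_value (f := Prod.fst) (motive := fun S : Finset (ℕ × ℕ) =>
    (∀ i j j', (i, j) ∈ S → (i, j') ∈ S → j = j') →
      ∃ H : List (ℕ × ℕ), (H.map Prod.fst).Pairwise (· < ·) ∧ H.toFinset = S) S ?_ ?_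
  · exact fun _ => ⟨[], by simp⟩
  · intro a s ha hmax ih hS
    obtain ⟨H, hH, rfl⟩ := ih fun i j j' h h' =>
      hS i j j' (Finset.mem_insert_of_mem h) (Finset.mem_insert_of_mem h')
    refine ⟨H ++ [a], ?_, ?_⟩
    · rw [List.map_append, List.pairwise_append]
      refine ⟨hH, by simp, ?_⟩
      simp only [List.map_cons, List.map_nil, List.mem_singleton, List.mem_map, forall_eq,
        forall_exists_index, and_imp]
      rintro _ x hx rfl
      refine lt_of_le_of_ne (hmax x (List.mem_toFinset.2 hx)) fun heq => ha ?_
      have hxa : x = a := Prod.ext heq (hS a.1 x.2 a.2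
        (heq ▸ Finset.mem_insert_of_mem (List.mem_toFinset.2 hx)) (Finset.mem_insert_self _ _))
      exact hxa ▸ List.mem_toFinset.2 hx
    · rw [List.toFinset_append]
      rw [Finset.insert_eq, Finset.union_comm]
      rfl

lemma finsum_catComp {T : Set (List (ℕ × ℕ))}
    (hT : ∀ H, H ∈ T ↔ (H.map Prod.fst).Pairwise (· < ·) ∧
      SegVHC (entry w) b 0 w.length H.toFinset) :
    ∑ᶠ H ∈ T, CatComp w H =
      ∑ S ∈ segVHCs (entry w) b (w.length + 1) 0 w.length,
        hookWeight (w.length + 1) 0 w.length S := by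
  rw [← finsum_mem_coe_finset]
  refine finsum_mem_eq_of_bijOn List.toFinset ⟨?_, ?_, ?_⟩ ?_
  · intro H hH
    exact (mem_segVHCs (Nat.lt_succ_self _)).2 ((hT H).1 hH).2
  · intro H hH H' hH' heq
    have h1 := List.pairwise_map.1 ((hT H).1 hH).1
    have h2 := List.pairwise_map.1 ((hT H').1 hH').1
    have hp : H.Perm H' := List.perm_of_nodup_nodup_toFinset_eq
      (h1.imp fun h => by rintro rfl; omega) (h2.imp fun h => by rintro rfl; omega) heq
    exact hp.eq_of_pairwise (fun _ _ _ _ h h' => absurd h (by omega)) h1 h2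
  · intro S hS
    have hS' := (mem_segVHCs (Nat.lt_succ_self _)).1 (Finset.mem_coe.1 hS)
    obtain ⟨H, hH, rfl⟩ := exists_sorted_list S hS'.inj
    exact ⟨H, (hT H).2 ⟨hH, hS'⟩, rfl⟩
  · intro H hH
    exact ((hT H).1 hH).2.catComp_eq ((hT H).1 hH).1

lemma segWord_entry (w : List ℕ) : segWord (entry w) 0 w.length = w := by
  apply List.ext_getElem
  · simp [segWord]
  · intro i h1 h2
    simp [segWord, entry, h2, Nat.add_comm 1 i]

lemma IsTreeSort.ncard_preimages {s : List ℕ → List ℕ} (hs : IsTreeSort b s)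
    {T : Set (List (ℕ × ℕ))}
    (hT : ∀ H, H ∈ T ↔ (H.map Prod.fst).Pairwise (· < ·) ∧
      SegVHC (entry w) b 0 w.length H.toFinset) :
    {u : List ℕ | s u = w}.ncard = ∑ᶠ H ∈ T, CatComp w H := by
  obtain ⟨P, hP, hcard⟩ := hs.exists_preimages (e := entry w) (w.length + 1)
    (Nat.zero_le w.length) (Nat.lt_succ_self _)
  rw [finsum_catComp hT, ← hcard, ← Set.ncard_coe_finset]
  congr 1
  ext u
  rw [Finset.mem_coe, hP, segWord_entry]
  rfl

end ListConfigurations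

/-- For every word `w`, the number of preimages of `w` under `fast` equals
`∑_{H ∈ H_R(w)} C_{q^H}`, and the number of preimages of `w` under `slow` equals
`∑_{H ∈ H_L(w)} C_{q^H}`. -/
theorem fertility_eq_sum_over_VHCs (w : List ℕ) (hw : 0 ∉ w) :
    {u : List ℕ | fast u = w}.ncard = ∑ᶠ H ∈ HR w, CatComp w H ∧
    {u : List ℕ | slow u = w}.ncard = ∑ᶠ H ∈ HL w, CatComp w H :=
  ⟨isTreeSort_fast.ncard_preimages fun _ => mem_HR_iff,
    isTreeSort_slow.ncard_preimages fun _ => mem_HL_iff⟩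
end

section
/- For every nonnegative integer f, there exists a word w such that the number of words u with fast(u) = w and the number of words u with slow(u) = w are both equal to f. -/
lemma fast_eq {w : List ℕ} (h : w ≠ []) :
    fast w = ((blocks (w.foldr max 0) w).map fast).flatten ++
      List.replicate (w.count (w.foldr max 0)) (w.foldr max 0) := by
  rw [fast, dif_neg h]
  congr 2
  exact List.attach_map_val (f := fast)

lemma slow_eq {w : List ℕ} (h : w ≠ []) :
    slow w = slow (blocks (w.foldr max 0) w).headI ++
      ((blocks (w.foldr max 0) w).tail.map fun A => slow A ++ [w.foldr max 0]).flatten := by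
  rw [slow, dif_neg h]
  congr 2
  exact List.attach_map_val (f := fun A => slow A ++ [w.foldr max 0])

lemma headI_append_flatten_tail {α : Type*} (l : List (List α)) :
    l.headI ++ l.tail.flatten = l.flatten := by
  cases l <;> rfl

lemma blocks_flatten_perm (n : ℕ) (w : List ℕ) :
    ((blocks n w).flatten ++ List.replicate (w.count n) n).Perm w := by
  induction w with
  | nil => simp [blocks]
  | cons a l ih =>
    by_cases h : a = n
    · subst h
      simp only [blocks, if_pos, List.count_cons_self, List.replicate_succ, List.flatten_cons,
        List.nil_append]
      exact List.perm_middle.trans (ih.cons a)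
    · simp only [blocks, if_neg h, List.count_cons_of_ne h, List.flatten_cons, List.cons_append,
        headI_append_flatten_tail]
      exact ih.cons a

lemma length_tail_blocks (n : ℕ) (w : List ℕ) : (blocks n w).tail.length = w.count n := by
  induction w with
  | nil => simp [blocks]
  | cons a l ih =>
    by_cases h : a = n
    · subst h
      have := List.length_pos_of_ne_nil (blocks_ne_nil a l)
      simp only [List.length_tail] at ih
      simp only [blocks, if_pos, List.tail_cons, List.count_cons_self]
      omega
    · simpa [blocks, h, List.count_cons_of_ne h] using ih

lemma flatten_map_perm {α : Type*} {g : List α → List α} {L : List (List α)}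
    (h : ∀ A ∈ L, (g A).Perm A) : (L.map g).flatten.Perm L.flatten := by
  induction L with
  | nil => simp
  | cons A L ih =>
    simp only [List.map_cons, List.flatten_cons]
    exact (h A List.mem_cons_self).append (ih fun B hB => h B (List.mem_cons_of_mem _ hB))

lemma flatten_map_append_singleton_perm {α : Type*} (g : List α → List α) (n : α)
    (L : List (List α)) :
    (L.map fun A => g A ++ [n]).flatten.Perm
      ((L.map g).flatten ++ List.replicate L.length n) := by
  induction L with
  | nil => simp
  | cons A L ih =>
    simp only [List.map_cons, List.flatten_cons, List.length_cons, List.replicate_succ,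
      List.append_assoc, List.singleton_append]
    exact ((ih.cons n).trans List.perm_middle.symm).append_left (g A)

lemma length_lt_of_mem_blocks {w A : List ℕ} (h : w ≠ [])
    (hA : A ∈ blocks (w.foldr max 0) w) : A.length < w.length := by
  have h1 := blocks_length hA
  have h2 : 0 < w.count (w.foldr max 0) := List.count_pos_iff.mpr (foldr_max_mem h)
  omega

lemma fast_perm (w : List ℕ) : (fast w).Perm w := by
  induction hn : w.length using Nat.strong_induction_on generalizing w with
  | _ n ih =>
    subst hn
    rcases eq_or_ne w [] with rfl | h
    · simp [fast]
    rw [fast_eq h]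
    refine .trans (.append_right _ (flatten_map_perm fun A hA => ?_)) (blocks_flatten_perm _ w)
    exact ih _ (length_lt_of_mem_blocks h hA) A rfl

lemma slow_perm (w : List ℕ) : (slow w).Perm w := by
  induction hn : w.length using Nat.strong_induction_on generalizing w with
  | _ n ih =>
    subst hn
    rcases eq_or_ne w [] with rfl | h
    · simp [slow]
    have hb : ∀ A ∈ blocks (w.foldr max 0) w, (slow A).Perm A := fun A hA =>
      ih _ (length_lt_of_mem_blocks h hA) A rfl
    rw [slow_eq h]
    refine .trans ?_ (blocks_flatten_perm (w.foldr max 0) w)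
    rw [← headI_append_flatten_tail (blocks _ w), List.append_assoc, ← length_tail_blocks]
    refine (hb _ (headI_mem (blocks_ne_nil _ w))).append ?_
    exact (flatten_map_append_singleton_perm _ _ _).trans
      ((flatten_map_perm fun A hA => hb A (List.mem_of_mem_tail hA)).append_right _)

lemma foldr_max_replicate_two (a b : ℕ) :
    (List.replicate a 1 ++ 2 :: List.replicate b 1).foldr max 0 = 2 := by
  have hb : (List.replicate b 1).foldr max 0 ≤ 1 := by
    induction b with
    | zero => simp
    | succ b ih => simpa [List.replicate_succ] using ih
  induction a with
  | zero => simp only [List.replicate_zero, List.nil_append, List.foldr_cons]; omega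
  | succ a ih => simp only [List.replicate_succ, List.cons_append, List.foldr_cons, ih]; rfl

lemma blocks_replicate_two (a b : ℕ) :
    blocks 2 (List.replicate a 1 ++ 2 :: List.replicate b 1) =
      [List.replicate a 1, List.replicate b 1] := by
  have hb : blocks 2 (List.replicate b 1) = [List.replicate b 1] := by
    induction b with
    | zero => simp [blocks]
    | succ b ih => simp [List.replicate_succ, blocks, ih]
  induction a with
  | zero => simp [blocks, hb]
  | succ a ih => simp [List.replicate_succ, blocks, ih]

lemma fast_replicate_two (a b : ℕ) :
    fast (List.replicate a 1 ++ 2 :: List.replicate b 1) = List.replicate (a + b) 1 ++ [2] := by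
  have h (c : ℕ) : fast (List.replicate c 1) = List.replicate c 1 :=
    List.perm_replicate.mp (fast_perm _)
  rw [fast_eq (by simp), foldr_max_replicate_two, blocks_replicate_two]
  simp [h, List.count_replicate]

lemma slow_replicate_two (a b : ℕ) :
    slow (List.replicate a 1 ++ 2 :: List.replicate b 1) = List.replicate (a + b) 1 ++ [2] := by
  have h (c : ℕ) : slow (List.replicate c 1) = List.replicate c 1 :=
    List.perm_replicate.mp (slow_perm _)
  rw [slow_eq (by simp), foldr_max_replicate_two, blocks_replicate_two]
  simp [h, ← List.replicate_append_replicate]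

lemma exists_eq_of_perm_replicate_two {u : List ℕ} {j : ℕ}
    (h : u.Perm (List.replicate j 1 ++ [2])) :
    ∃ a b, a + b = j ∧ u = List.replicate a 1 ++ 2 :: List.replicate b 1 := by
  obtain ⟨s, t, rfl⟩ := List.append_of_mem (h.mem_iff.mpr (by simp : 2 ∈ _))
  have hst : (s ++ t).Perm (List.replicate j 1) :=
    (List.perm_middle.symm.trans (h.trans (List.perm_append_comm))).cons_inv
  obtain ⟨hl, hs, ht⟩ := List.append_eq_replicate_iff.mp (List.perm_replicate.mp hst)
  exact ⟨s.length, t.length, hl, by rw [← hs, ← ht]⟩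

lemma preimage_replicate_two {g : List ℕ → List ℕ} (hp : ∀ u, (g u).Perm u)
    (hg : ∀ a b, g (List.replicate a 1 ++ 2 :: List.replicate b 1) =
      List.replicate (a + b) 1 ++ [2]) (j : ℕ) :
    {u | g u = List.replicate j 1 ++ [2]}.Finite ∧
      {u | g u = List.replicate j 1 ++ [2]}.ncard = j + 1 := by
  let e : ℕ → List ℕ := fun a => List.replicate a 1 ++ 2 :: List.replicate (j - a) 1
  have he : Function.Injective e := fun a b hab => by
    simpa [e, List.idxOf_append, List.mem_replicate] using congrArg (List.idxOf 2) hab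
  have hset : {u | g u = List.replicate j 1 ++ [2]} = ((Finset.range (j + 1)).image e : Set _) := by
    ext u
    simp only [Set.mem_ofPred_eq, Finset.coe_image, Finset.coe_range, Set.mem_image, Set.mem_Iio]
    constructor
    · intro h
      obtain ⟨a, b, rfl, rfl⟩ := exists_eq_of_perm_replicate_two (h ▸ (hp u).symm)
      exact ⟨a, by omega, by simp [e]⟩
    · rintro ⟨a, ha, rfl⟩
      rw [hg, Nat.add_sub_cancel' (by omega)]
  rw [hset]
  exact ⟨Finset.finite_toSet _, by
    rw [Set.ncard_coe_finset, Finset.card_image_of_injective _ he, Finset.card_range]⟩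

lemma preimage_two_one {g : List ℕ → List ℕ} (hp : ∀ u, (g u).Perm u)
    (hg : ∀ a b, g (List.replicate a 1 ++ 2 :: List.replicate b 1) =
      List.replicate (a + b) 1 ++ [2]) : {u | g u = [2, 1]} = ∅ := by
  refine Set.eq_empty_of_forall_notMem fun u (h : g u = [2, 1]) => ?_
  obtain ⟨a, b, hab, rfl⟩ := exists_eq_of_perm_replicate_two (u := u) (j := 1)
    ((hp u).symm.trans (h ▸ List.Perm.swap 1 2 []))
  rw [hg, hab] at h
  simp at h

/-- For every nonnegative integer `f`, there exists a word `w` such that the number of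
words `u` with `fast u = w` and the number of words `u` with `slow u = w` are both
equal to `f`. -/
theorem all_fertility_numbers (f : ℕ) :
    ∃ w : List ℕ, 0 ∉ w ∧
      {u : List ℕ | fast u = w}.Finite ∧ {u : List ℕ | slow u = w}.Finite ∧
      {u : List ℕ | fast u = w}.ncard = f ∧ {u : List ℕ | slow u = w}.ncard = f := by
  cases f with
  | zero =>
    refine ⟨[2, 1], by simp, ?_⟩
    simp [preimage_two_one fast_perm fast_replicate_two,
      preimage_two_one slow_perm slow_replicate_two]
  | succ j =>
    obtain ⟨hf, hf'⟩ := preimage_replicate_two fast_perm fast_replicate_two j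
    obtain ⟨hs, hs'⟩ := preimage_replicate_two slow_perm slow_replicate_two j
    exact ⟨List.replicate j 1 ++ [2], by simp [List.mem_replicate], hf, hs, hf', hs'⟩
end
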